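/- Let H be an N×N hermitian Wigner matrix satisfying condition C1. For any κ > 0 there exist constants C = C(κ) and c = c(κ) such that P( there exists a unit vector v with Hv = μv for some μ ∈ [−2+κ, 2−κ] and ‖v‖_∞ ≥ M N^{−1/2} ) ≤ C e^{−c√M} for all M ≥ (log N)⁴ and all N ≥ 2, where ‖v‖_∞ is the maximum absolute value of the coordinates of v. -/

import Mathlib

open MeasureTheory ProbabilityTheory
open scoped ENNReal NNReal

noncomputable section

/-- The density of the Wigner semicircle law. -/
def rhoSC (x : ℝ) : ℝ := if |x| ≤ 2 then Real.sqrt (4 - x ^ 2) / (2 * Real.pi) else 0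

/-- The Stieltjes transform of the Wigner semicircle law. -/
def mSC (z : ℂ) : ℂ := ∫ x : ℝ, (rhoSC x : ℂ) / ((x : ℂ) - z)

/-- The Stieltjes transform of the empirical eigenvalue distribution of a matrix:
`m(z) = N⁻¹ Tr (H - z)⁻¹`. -/
def stTrans {N : ℕ} (A : Matrix (Fin N) (Fin N) ℂ) (z : ℂ) : ℂ :=
  (Matrix.trace (A - z • (1 : Matrix (Fin N) (Fin N) ℂ))⁻¹) / (N : ℂ)

open scoped Classical in
/-- The number of eigenvalues (with multiplicity) of a Hermitian matrix lying in a set `I`. -/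
def eigCount {N : ℕ} {A : Matrix (Fin N) (Fin N) ℂ} (hA : A.IsHermitian) (I : Set ℝ) : ℕ :=
  (Finset.univ.filter fun i => hA.eigenvalues i ∈ I).card

/-- `ν` has a strictly positive density `h` on `ℝ² ≃ ℂ` which is either a product of two copies
of a one-variable function or radially symmetric. -/
def WignerDensityOf (ν : Measure ℂ) (h : ℝ → ℝ → ℝ) : Prop :=
  (∀ x y, 0 < h x y) ∧
  ν = (volume : Measure ℂ).withDensity (fun z => ENNReal.ofReal (h z.re z.im)) ∧
  ((∃ hs : ℝ → ℝ, ∀ x y, h x y = hs x * hs y) ∨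
   (∃ hs : ℝ → ℝ, ∀ x y, h x y = hs (x ^ 2 + y ^ 2)))

/-- Condition C1, with explicit constants: Gaussian moments of the off-diagonal law `ν`
and of the diagonal law `ν'` are bounded by `D` resp. `D'`. -/
def CondC1 (ν : Measure ℂ) (ν' : Measure ℝ) (δ₀ D D' : ℝ) : Prop :=
  0 < δ₀ ∧
  (∫⁻ z, ENNReal.ofReal (Real.exp (δ₀ * ‖z‖ ^ 2)) ∂ν) ≤ ENNReal.ofReal D ∧
  (∫⁻ x, ENNReal.ofReal (Real.exp (δ₀ * x ^ 2)) ∂ν') ≤ ENNReal.ofReal D'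

/-- `H` is an `N × N` hermitian Wigner ensemble on the probability space `(Ω, P)`:
the entries above the diagonal are i.i.d. with law `N^{-1/2} ν` where `ν` has mean zero,
variance one and a density as in `WignerDensityOf`; the diagonal entries are real i.i.d.
with law `N^{-1/2} ν'`, `ν'` of mean zero; and all these entries are independent. -/
structure IsWignerMatrix {Ω : Type} [MeasurableSpace Ω] (P : Measure Ω) (N : ℕ)
    (H : Ω → Matrix (Fin N) (Fin N) ℂ) (ν : Measure ℂ) (ν' : Measure ℝ) : Prop where
  herm : ∀ ω, (H ω).IsHermitian
  prob : IsProbabilityMeasure P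
  probν : IsProbabilityMeasure ν
  probν' : IsProbabilityMeasure ν'
  density : ∃ h, WignerDensityOf ν h
  mean : (∫ z, z ∂ν) = 0
  var : (∫ z, ‖z‖ ^ 2 ∂ν) = 1
  mean' : (∫ x, x ∂ν') = 0
  offdiag : ∀ i j : Fin N, i < j →
    P.map (fun ω => (Real.sqrt N : ℂ) * H ω i j) = ν
  diag : ∀ i : Fin N, P.map (fun ω => Real.sqrt N * (H ω i i).re) = ν'
  diag_real : ∀ ω i, (H ω i i).im = 0
  indep : iIndepFun
    (fun (p : {p : Fin N × Fin N // p.1 ≤ p.2}) (ω : Ω) => H ω p.1.1 p.1.2) P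
/-- The Fourier transform on `ℝ²` of a real function of two variables. -/
def fourier2 (f : ℝ → ℝ → ℝ) (t s : ℝ) : ℂ :=
  ∫ x : ℝ, ∫ y : ℝ, Complex.exp (-Complex.I * (t * x + s * y)) * (f x y : ℂ)

/-- The Laplacian of a function of two real variables. -/
def laplacian2 (g : ℝ → ℝ → ℝ) (x y : ℝ) : ℝ :=
  deriv (deriv (fun t => g t y)) x + deriv (deriv (fun t => g x t)) y

/-- Condition C2 with exponent `a` and constants `w`, `w'`: decay of the Fourier transforms
of the density `h` and of `h · Δ(-log h)`. -/
def CondC2 (h : ℝ → ℝ → ℝ) (a : ℕ) (w w' : ℝ) : Prop :=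
  0 < w ∧ 0 < w' ∧
  (∀ t s : ℝ, ‖fourier2 h t s‖ ≤ 1 / (1 + w * (t ^ 2 + s ^ 2)) ^ a) ∧
  (∀ t s : ℝ, ‖fourier2
      (fun x y => h x y * laplacian2 (fun u v => -Real.log (h u v)) x y) t s‖
    ≤ 1 / (1 + w' * (t ^ 2 + s ^ 2)) ^ a)

/-- Either the real and imaginary parts under `ν` are i.i.d., or `ν` is rotationally
symmetric. -/
def ComplexSymm (ν : Measure ℂ) : Prop :=
  (∃ μ₀ : Measure ℝ,
    ν = Measure.map (fun p : ℝ × ℝ => (p.1 : ℂ) + p.2 * Complex.I) (μ₀.prod μ₀)) ∨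
  (∀ θ : ℝ, Measure.map (fun z => Complex.exp (θ * Complex.I) * z) ν = ν)
set_option linter.unusedSimpArgs false

def rsv {n : ℕ} (A : Matrix (Fin n) (Fin n) ℂ) (z : ℂ) : Matrix (Fin n) (Fin n) ℂ :=
  (A - z • (1 : Matrix (Fin n) (Fin n) ℂ))⁻¹

lemma rsv_isUnit {n : ℕ} {A : Matrix (Fin n) (Fin n) ℂ} (hA : A.IsHermitian) {z : ℂ}
    (hz : 0 < z.im) : IsUnit (A - z • (1 : Matrix (Fin n) (Fin n) ℂ)).det := by
  rw [isUnit_iff_ne_zero]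
  intro h0
  obtain ⟨v, hv, h⟩ := Matrix.exists_mulVec_eq_zero_iff.mpr h0
  have h1 : A.mulVec v = z • v := by
    rw [Matrix.sub_mulVec, Matrix.smul_mulVec, Matrix.one_mulVec, sub_eq_zero] at h
    exact h
  have h2 : star v ⬝ᵥ A.mulVec v = z * (star v ⬝ᵥ v) := by
    rw [h1, dotProduct_smul, smul_eq_mul]
  have h3 : star (star v ⬝ᵥ A.mulVec v) = star v ⬝ᵥ A.mulVec v := by
    rw [← Matrix.star_dotProduct_star, star_star, Matrix.star_mulVec, hA.eq, dotProduct_comm,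
      Matrix.dotProduct_mulVec, dotProduct_comm]
  have h4 : star (star v ⬝ᵥ v) = star v ⬝ᵥ v := by
    rw [← Matrix.star_dotProduct_star, star_star, dotProduct_comm]
  have h5 : star v ⬝ᵥ v ≠ 0 := by
    open scoped ComplexOrder in
    rwa [Ne, dotProduct_star_self_eq_zero]
  rw [h2, star_mul, h4, mul_comm] at h3
  have h6 := mul_right_cancel₀ h5 h3
  have := Complex.conj_eq_iff_im.mp h6
  linarith

lemma mul_rsv {n : ℕ} {A : Matrix (Fin n) (Fin n) ℂ} (hA : A.IsHermitian) {z : ℂ}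
    (hz : 0 < z.im) : (A - z • (1 : Matrix (Fin n) (Fin n) ℂ)) * rsv A z = 1 :=
  Matrix.mul_nonsing_inv _ (rsv_isUnit hA hz)

lemma rsv_mul {n : ℕ} {A : Matrix (Fin n) (Fin n) ℂ} (hA : A.IsHermitian) {z : ℂ}
    (hz : 0 < z.im) : rsv A z * (A - z • (1 : Matrix (Fin n) (Fin n) ℂ)) = 1 :=
  Matrix.nonsing_inv_mul _ (rsv_isUnit hA hz)

lemma rsv_star {n : ℕ} {A : Matrix (Fin n) (Fin n) ℂ} (hA : A.IsHermitian) {z : ℂ} :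
    (rsv A z).conjTranspose = (A - (star z) • (1 : Matrix (Fin n) (Fin n) ℂ))⁻¹ := by
  rw [rsv, Matrix.conjTranspose_nonsing_inv, Matrix.conjTranspose_sub, hA.eq,
    Matrix.conjTranspose_smul, Matrix.conjTranspose_one]

/-- resolvent identity G - G^* = (z - zbar) G G^*. -/
lemma rsv_ward1 {n : ℕ} {A : Matrix (Fin n) (Fin n) ℂ} (hA : A.IsHermitian) {z : ℂ}
    (hz : 0 < z.im) : rsv A z - (rsv A z).conjTranspose =
      (z - star z) • (rsv A z * (rsv A z).conjTranspose) := by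
  have h1 := rsv_mul hA hz
  have h2 := congrArg Matrix.conjTranspose h1
  rw [Matrix.conjTranspose_mul, Matrix.conjTranspose_one, Matrix.conjTranspose_sub, hA.eq,
    Matrix.conjTranspose_smul, Matrix.conjTranspose_one] at h2
  set G := rsv A z
  have : G * ((A - star z • 1) - (A - z • 1)) * G.conjTranspose =
      G * ((A - star z • 1) * G.conjTranspose) - (G * (A - z • 1)) * G.conjTranspose := by
    noncomm_ring
  rw [h1, h2, mul_one, one_mul] at this
  rw [← this]
  simp only [sub_sub_sub_cancel_left, ← sub_smul, Matrix.mul_smul, mul_one, Matrix.smul_mul]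

lemma rsv_ward2 {n : ℕ} {A : Matrix (Fin n) (Fin n) ℂ} (hA : A.IsHermitian) {z : ℂ}
    (hz : 0 < z.im) : rsv A z - (rsv A z).conjTranspose =
      (z - star z) • ((rsv A z).conjTranspose * rsv A z) := by
  have h1 := mul_rsv hA hz
  have h2 := congrArg Matrix.conjTranspose h1
  rw [Matrix.conjTranspose_mul, Matrix.conjTranspose_one, Matrix.conjTranspose_sub, hA.eq,
    Matrix.conjTranspose_smul, Matrix.conjTranspose_one] at h2
  set G := rsv A z
  have : G.conjTranspose * ((A - star z • 1) - (A - z • 1)) * G =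
      (G.conjTranspose * (A - star z • 1)) * G - G.conjTranspose * ((A - z • 1) * G) := by
    noncomm_ring
  rw [h1, h2, mul_one, one_mul] at this
  rw [← this]
  simp only [sub_sub_sub_cancel_left, ← sub_smul, Matrix.mul_smul, mul_one, Matrix.smul_mul]

lemma ward_row {n : ℕ} {A : Matrix (Fin n) (Fin n) ℂ} (hA : A.IsHermitian) {z : ℂ}
    (hz : 0 < z.im) (i : Fin n) : z.im * ∑ j, ‖rsv A z i j‖ ^ 2 = (rsv A z i i).im := by
  have h := congrFun (congrFun (rsv_ward1 hA hz) i) i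
  have h' := congrArg Complex.im h
  have e : (rsv A z * (rsv A z).conjTranspose) i i = ((∑ j, ‖rsv A z i j‖ ^ 2 : ℝ) : ℂ) := by
    simp only [Matrix.mul_apply, Matrix.conjTranspose_apply]
    push_cast
    exact Finset.sum_congr rfl fun j _ => by
      rw [Complex.star_def, Complex.mul_conj, Complex.normSq_eq_norm_sq]; push_cast; rfl
  rw [Matrix.smul_apply, e] at h'
  simp at h'
  simp only [← Complex.ofReal_pow, ← Complex.ofReal_sum, Complex.ofReal_re, Complex.ofReal_im] at h'
  linarith

lemma ward_col {n : ℕ} {A : Matrix (Fin n) (Fin n) ℂ} (hA : A.IsHermitian) {z : ℂ}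
    (hz : 0 < z.im) (i : Fin n) : z.im * ∑ j, ‖rsv A z j i‖ ^ 2 = (rsv A z i i).im := by
  have h := congrFun (congrFun (rsv_ward2 hA hz) i) i
  have h' := congrArg Complex.im h
  have e : ((rsv A z).conjTranspose * rsv A z) i i = ((∑ j, ‖rsv A z j i‖ ^ 2 : ℝ) : ℂ) := by
    simp only [Matrix.mul_apply, Matrix.conjTranspose_apply]
    push_cast
    exact Finset.sum_congr rfl fun j _ => by
      rw [mul_comm, Complex.star_def, Complex.mul_conj, Complex.normSq_eq_norm_sq]; push_cast; rfl
  rw [Matrix.smul_apply, e] at h'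
  simp at h'
  simp only [← Complex.ofReal_pow, ← Complex.ofReal_sum, Complex.ofReal_re, Complex.ofReal_im] at h'
  linarith

lemma rsv_im_nonneg {n : ℕ} {A : Matrix (Fin n) (Fin n) ℂ} (hA : A.IsHermitian) {z : ℂ}
    (hz : 0 < z.im) (i : Fin n) : 0 ≤ (rsv A z i i).im := by
  rw [← ward_row hA hz]; positivity

lemma rsv_diag_le {n : ℕ} {A : Matrix (Fin n) (Fin n) ℂ} (hA : A.IsHermitian) {z : ℂ}
    (hz : 0 < z.im) (i : Fin n) : ‖rsv A z i i‖ ≤ 1 / z.im := by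
  have h := ward_row hA hz i
  have h1 : ‖rsv A z i i‖ ^ 2 ≤ ∑ j, ‖rsv A z i j‖ ^ 2 :=
    Finset.single_le_sum (f := fun j => ‖rsv A z i j‖ ^ 2) (fun j _ => by positivity)
      (Finset.mem_univ i)
  have h2 : (rsv A z i i).im ≤ ‖rsv A z i i‖ := (le_abs_self _).trans (Complex.abs_im_le_norm _)
  rw [le_div_iff₀ hz]
  by_contra hc
  push Not at hc
  have h3 : 0 < ‖rsv A z i i‖ := by
    rcases (norm_nonneg (rsv A z i i)).eq_or_lt with h0 | h0
    · rw [← h0] at hc; linarith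
    · exact h0
  nlinarith [mul_le_mul_of_nonneg_left h1 hz.le, mul_pos h3 hz]

/-- sum of products bound. -/
lemma rsv_cs {n : ℕ} {A : Matrix (Fin n) (Fin n) ℂ} (hA : A.IsHermitian) {z w : ℂ}
    (hz : 0 < z.im) (hw : 0 < w.im) (i : Fin n) :
    ‖∑ j, rsv A z i j * rsv A w j i‖ ^ 2 * (z.im * w.im) ≤ ‖rsv A z i i‖ * ‖rsv A w i i‖ := by
  have h1 : ‖∑ j, rsv A z i j * rsv A w j i‖ ≤ ∑ j, ‖rsv A z i j‖ * ‖rsv A w j i‖ :=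
    (norm_sum_le _ _).trans (Finset.sum_le_sum fun j _ => by rw [norm_mul])
  have h2 := Finset.sum_mul_sq_le_sq_mul_sq Finset.univ (fun j => ‖rsv A z i j‖)
    (fun j => ‖rsv A w j i‖)
  have h3 : ‖∑ j, rsv A z i j * rsv A w j i‖ ^ 2 ≤
    (∑ j, ‖rsv A z i j‖ * ‖rsv A w j i‖) ^ 2 := by gcongr
  have h4 := ward_row hA hz i
  have h5 := ward_col hA hw i
  calc _ ≤ ((∑ j, ‖rsv A z i j‖ ^ 2) * ∑ j, ‖rsv A w j i‖ ^ 2) * (z.im * w.im) := by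
        gcongr; exact h3.trans h2
    _ = (rsv A z i i).im * (rsv A w i i).im := by rw [← h4, ← h5]; ring
    _ ≤ _ := by
        apply mul_le_mul ((le_abs_self _).trans (Complex.abs_im_le_norm _))
          ((le_abs_self _).trans (Complex.abs_im_le_norm _)) (rsv_im_nonneg hA hw i) (norm_nonneg _)

lemma rsv_double {n : ℕ} {A : Matrix (Fin n) (Fin n) ℂ} (hA : A.IsHermitian) {z w : ℂ}
    (hz : 0 < z.im) (hw : w = z + z.im * Complex.I) (i : Fin n) :
    ‖rsv A z i i‖ ≤ 2 * ‖rsv A w i i‖ := by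
  have hwi : w.im = 2 * z.im := by rw [hw]; simp; ring
  have hw0 : 0 < w.im := by linarith
  have key : rsv A z - rsv A w = (z - w) • (rsv A z * rsv A w) := by
    have h1 := rsv_mul hA hz
    have h2 := mul_rsv hA hw0
    set G := rsv A z
    set G' := rsv A w
    have : G * ((A - w • 1) - (A - z • 1)) * G' =
      G * ((A - w • 1) * G') - (G * (A - z • 1)) * G' := by
      noncomm_ring
    rw [h1, h2, mul_one, one_mul] at this
    rw [← this]
    simp only [sub_sub_sub_cancel_left, ← sub_smul, Matrix.mul_smul, mul_one, Matrix.smul_mul]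
  have h := congrFun (congrFun key i) i
  simp only [Matrix.sub_apply, Matrix.smul_apply, Matrix.mul_apply, smul_eq_mul] at h
  have hcs := rsv_cs hA hz hw0 i
  set S := ∑ j, rsv A z i j * rsv A w j i
  have hn : ‖z - w‖ = z.im := by
    rw [hw]; simp [abs_of_pos hz]
  have h1 : ‖rsv A z i i‖ ≤ ‖rsv A w i i‖ + z.im * ‖S‖ := by
    have : rsv A z i i = rsv A w i i + (z - w) * S := by rw [← h]; ring
    rw [this]
    refine (norm_add_le _ _).trans ?_
    rw [norm_mul, hn]
  rw [hwi] at hcs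
  set g := ‖rsv A z i i‖
  set k := ‖rsv A w i i‖
  have hg : 0 ≤ g := norm_nonneg _
  have hk : 0 ≤ k := norm_nonneg _
  have h2 : z.im * ‖S‖ ≤ g / 4 + k / 2 := by
    apply abs_le_of_sq_le_sq' _ (by positivity) |>.2
    nlinarith [sq_nonneg (g / 4 - k / 2)]
  linarith

lemma eigvec_bound {n : ℕ} {A : Matrix (Fin n) (Fin n) ℂ} (hA : A.IsHermitian) {z : ℂ}
    (hz : 0 < z.im) {μ : ℂ} {v : Fin n → ℂ} (hv : A.mulVec v = μ • v)
    (hn : ∑ i, ‖v i‖ ^ 2 = 1) (i : Fin n) :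
    ‖v i‖ ^ 2 * z.im ≤ ‖μ - z‖ ^ 2 * ‖rsv A z i i‖ := by
  have h1 : (A - z • (1 : Matrix (Fin n) (Fin n) ℂ)).mulVec v = (μ - z) • v := by
    rw [Matrix.sub_mulVec, hv, Matrix.smul_mulVec, Matrix.one_mulVec, sub_smul]
  have h2 : v = (μ - z) • (rsv A z).mulVec v := by
    rw [← Matrix.mulVec_smul, ← h1, Matrix.mulVec_mulVec, rsv_mul hA hz, Matrix.one_mulVec]
  have h3 : v i = (μ - z) * ∑ j, rsv A z i j * v j := by
    conv_lhs => rw [h2]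
    simp [Matrix.mulVec, dotProduct]
  have h4 : ‖∑ j, rsv A z i j * v j‖ ≤ ∑ j, ‖rsv A z i j‖ * ‖v j‖ :=
    (norm_sum_le _ _).trans (Finset.sum_le_sum fun j _ => by rw [norm_mul])
  have h5 := Finset.sum_mul_sq_le_sq_mul_sq Finset.univ (fun j => ‖rsv A z i j‖)
    (fun j => ‖v j‖)
  rw [hn, mul_one] at h5
  have h6 : ‖∑ j, rsv A z i j * v j‖ ^ 2 ≤ ∑ j, ‖rsv A z i j‖ ^ 2 := by
    refine le_trans ?_ h5
    gcongr
  rw [h3, norm_mul, mul_pow, mul_assoc]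
  gcongr
  calc _ ≤ (∑ j, ‖rsv A z i j‖ ^ 2) * z.im := by gcongr
    _ = (rsv A z i i).im := by rw [mul_comm, ward_row hA hz]
    _ ≤ _ := (le_abs_self _).trans (Complex.abs_im_le_norm _)

/-- the `i`-th minor -/
def minorM {n : ℕ} (A : Matrix (Fin (n+1)) (Fin (n+1)) ℂ) (i : Fin (n+1)) :
    Matrix (Fin n) (Fin n) ℂ := A.submatrix i.succAbove i.succAbove

lemma minor_herm {n : ℕ} {A : Matrix (Fin (n+1)) (Fin (n+1)) ℂ} (hA : A.IsHermitian)
    (i : Fin (n+1)) : (minorM A i).IsHermitian := hA.submatrix _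

/-- quadratic form -/
def qf {n : ℕ} (B : Matrix (Fin n) (Fin n) ℂ) (x : Fin n → ℂ) : ℂ :=
  ∑ j, ∑ k, star (x j) * B j k * x k

lemma rsv_col_minor {n : ℕ} {A : Matrix (Fin (n+1)) (Fin (n+1)) ℂ} (hA : A.IsHermitian) {z : ℂ}
    (hz : 0 < z.im) (i : Fin (n+1)) (j : Fin n) (k : Fin (n+1)) :
    rsv A z (i.succAbove j) k = (∑ l, rsv (minorM A i) z j l *
      (1 : Matrix (Fin (n+1)) (Fin (n+1)) ℂ) (i.succAbove l) k)
      - (∑ l, rsv (minorM A i) z j l * A (i.succAbove l) i) * rsv A z i k := by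
  have h1 : ∀ l : Fin n, A (i.succAbove l) i * rsv A z i k +
      ((minorM A i - z • 1).mulVec fun m => rsv A z (i.succAbove m) k) l =
      (1 : Matrix (Fin (n+1)) (Fin (n+1)) ℂ) (i.succAbove l) k := by
    intro l
    have := congrFun (congrFun (mul_rsv hA hz) (i.succAbove l)) k
    rw [← this, Matrix.mul_apply, Fin.sum_univ_succAbove _ i]
    congr 1
    · simp [Matrix.sub_apply, Matrix.smul_apply, Matrix.one_apply]
    · simp [Matrix.mulVec, dotProduct, minorM, Matrix.one_apply]
  have h2 : (minorM A i - z • 1).mulVec (fun m => rsv A z (i.succAbove m) k) =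
      fun l => (1 : Matrix (Fin (n+1)) (Fin (n+1)) ℂ) (i.succAbove l) k -
        A (i.succAbove l) i * rsv A z i k := by
    funext l; rw [← h1 l]; ring
  have h3 := congrArg (fun u => (rsv (minorM A i) z).mulVec u j) h2
  simp only [Matrix.mulVec_mulVec, rsv_mul (minor_herm hA i) hz, Matrix.one_mulVec] at h3
  rw [h3]
  simp only [Matrix.mulVec, dotProduct, mul_sub, Finset.sum_sub_distrib, Finset.sum_mul, mul_assoc]

lemma schur {n : ℕ} {A : Matrix (Fin (n+1)) (Fin (n+1)) ℂ} (hA : A.IsHermitian) {z : ℂ}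
    (hz : 0 < z.im) (i : Fin (n+1)) :
    rsv A z i i * (A i i - z - qf (rsv (minorM A i) z) (fun j => A (i.succAbove j) i)) = 1 := by
  have h := congrFun (congrFun (mul_rsv hA hz) i) i
  rw [Matrix.mul_apply, Fin.sum_univ_succAbove _ i] at h
  simp only [Matrix.sub_apply, Matrix.smul_apply, Matrix.one_apply_eq, smul_eq_mul, mul_one,
    Matrix.one_apply_ne (Fin.succAbove_ne i _).symm, mul_zero, sub_zero, rsv_col_minor hA hz i,
    Matrix.one_apply_ne (Fin.succAbove_ne i _), Finset.sum_const_zero, zero_sub] at h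
  rw [← h, qf]
  have : ∀ j, A i (i.succAbove j) = star (A (i.succAbove j) i) := fun j => (hA.apply _ _).symm
  simp only [this, mul_sub, sub_eq_add_neg, Finset.mul_sum, mul_neg, Finset.sum_neg_distrib,
    mul_assoc, Finset.sum_mul]
  ring_nf
  congr 1
  rw [Finset.mul_sum]
  refine Finset.sum_congr rfl fun j _ => ?_
  rw [Finset.mul_sum]
  exact Finset.sum_congr rfl fun k _ => by ring

lemma trace_minor {n : ℕ} {A : Matrix (Fin (n+1)) (Fin (n+1)) ℂ} (hA : A.IsHermitian) {z : ℂ}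
    (hz : 0 < z.im) (i : Fin (n+1)) :
    ‖(rsv A z).trace - (rsv (minorM A i) z).trace‖ ≤ 1 / z.im := by
  have hs := schur hA hz i
  have h0 : rsv A z i i ≠ 0 := left_ne_zero_of_mul_eq_one hs
  have h1 : ∀ j, rsv A z (i.succAbove j) (i.succAbove j) * rsv A z i i =
      rsv (minorM A i) z j j * rsv A z i i + 
        rsv A z i (i.succAbove j) * rsv A z (i.succAbove j) i := by
    intro j
    rw [rsv_col_minor hA hz i j (i.succAbove j), rsv_col_minor hA hz i j i]
    simp [Matrix.one_apply]
    ring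
  have h2 : ((rsv A z).trace - (rsv (minorM A i) z).trace) * rsv A z i i =
      ∑ j, rsv A z i j * rsv A z j i := by
    rw [Matrix.trace, Matrix.trace, Fin.sum_univ_succAbove _ i, Fin.sum_univ_succAbove _ i]
    simp only [Matrix.diag_apply, add_mul, sub_mul, Finset.sum_mul, h1, Finset.sum_add_distrib]
    ring
  have h3 := rsv_cs hA hz hz i
  rw [← h2, norm_mul] at h3
  set d := ‖(rsv A z).trace - (rsv (minorM A i) z).trace‖
  have hg : 0 < ‖rsv A z i i‖ := norm_pos_iff.mpr h0
  have h4 : (d * z.im) ^ 2 ≤ 1 ^ 2 := by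
    have : (d * z.im) ^ 2 * ‖rsv A z i i‖ ^ 2 ≤ 1 * ‖rsv A z i i‖ ^ 2 := by nlinarith
    rw [one_pow]
    exact le_of_mul_le_mul_right this (by positivity)
  rw [le_div_iff₀ hz]
  exact (abs_le_of_sq_le_sq' h4 (by norm_num)).2


lemma frob_minor {n : ℕ} {A : Matrix (Fin (n+1)) (Fin (n+1)) ℂ} (hA : A.IsHermitian) {z : ℂ}
    (hz : 0 < z.im) (i : Fin (n+1)) {C : ℝ} (hC : ∀ i, ‖rsv A z i i‖ ≤ C) :
    z.im * ∑ j, ∑ k, ‖rsv (minorM A i) z j k‖ ^ 2 ≤ (n + 1) * C + 1 / z.im := by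
  rw [Finset.mul_sum]
  simp_rw [ward_row (minor_herm hA i) hz]
  have h1 : ∑ j, (rsv (minorM A i) z j j).im = ((rsv (minorM A i) z).trace).im := by
    rw [Matrix.trace, Complex.im_sum]; rfl
  have h2 := trace_minor hA hz i
  have h3 : ‖(rsv A z).trace‖ ≤ (n + 1) * C := by
    rw [Matrix.trace]
    refine (norm_sum_le _ _).trans ((Finset.sum_le_sum fun j _ => hC j).trans ?_)
    simp
  rw [h1]
  calc _ ≤ ‖(rsv (minorM A i) z).trace‖ := (le_abs_self _).trans (Complex.abs_im_le_norm _)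
    _ = ‖(rsv A z).trace - ((rsv A z).trace - (rsv (minorM A i) z).trace)‖ := by congr 1; ring
    _ ≤ _ := (norm_sub_le _ _).trans (add_le_add h3 h2)

/-- deviation of the quadratic form -/
def qdev {n : ℕ} (A : Matrix (Fin (n+1)) (Fin (n+1)) ℂ) (z : ℂ) (i : Fin (n+1)) : ℂ :=
  qf (rsv (minorM A i) z) (fun j => A (i.succAbove j) i) - (rsv (minorM A i) z).trace / (n + 1 : ℂ)

lemma boot_step {n : ℕ} {A : Matrix (Fin (n+1)) (Fin (n+1)) ℂ} (hA : A.IsHermitian) {z : ℂ}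
    (hz : 0 < z.im) (hz1 : z.im ≤ 1) {c ε : ℝ} (hc : 0 < c) (hc1 : c ≤ 1 - z.re ^ 2 / 4)
    (hε : ε = c ^ 2 / 96) (hG : ∀ i, ‖rsv A z i i‖ ≤ 2 * (8 / c))
    (hd : ∀ i, ‖A i i‖ ≤ ε) (hQ : ∀ i, ‖qdev A z i‖ ≤ ε)
    (hη : 1 / ((n + 1) * z.im) ≤ ε) (i : Fin (n+1)) : ‖rsv A z i i‖ ≤ 8 / c := by
  have hc2 : c ≤ 1 := by nlinarith [sq_nonneg z.re]
  set m := (rsv A z).trace / (n + 1 : ℂ) with hm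
  have hn0 : (n + 1 : ℂ) ≠ 0 := by exact_mod_cast Nat.succ_ne_zero n
  have hnn : ‖(n + 1 : ℂ)‖ = (n:ℝ) + 1 := by
    have : (n + 1 : ℂ) = (((n:ℝ) + 1 : ℝ) : ℂ) := by push_cast; rfl
    rw [this, Complex.norm_real, Real.norm_of_nonneg (by positivity)]
  have hnp : (0:ℝ) < (n:ℝ) + 1 := by positivity
  have key : ∀ i, ∃ e : ℂ, ‖e‖ ≤ 3 * ε ∧ rsv A z i i * (-z - m + e) = 1 := by
    intro i
    refine ⟨A i i - qdev A z i + ((rsv A z).trace - (rsv (minorM A i) z).trace) / (n + 1 : ℂ),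
      ?_, ?_⟩
    · have h1 : ‖((rsv A z).trace - (rsv (minorM A i) z).trace) / (n + 1 : ℂ)‖ ≤ ε := by
        rw [norm_div, hnn]
        refine le_trans ?_ hη
        rw [mul_comm, ← div_div]
        gcongr
        exact trace_minor hA hz i
      calc _ ≤ ‖A i i‖ + ‖qdev A z i‖ + _ := (norm_add_le _ _).trans
            (add_le_add (norm_sub_le _ _) le_rfl)
        _ ≤ ε + ε + ε := add_le_add (add_le_add (hd i) (hQ i)) h1
        _ = _ := by ring
    · have hs := schur hA hz i
      rw [qdev, hm]
      refine Eq.trans ?_ hs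
      ring
  choose e he1 he2 using key
  have hr : ‖m ^ 2 + z * m + 1‖ ≤ 3 * ε * (2 * (8 / c)) := by
    have h1 : (m ^ 2 + z * m + 1) * (n + 1 : ℂ) = ∑ i, rsv A z i i * e i := by
      have : ∀ i, rsv A z i i * e i = 1 + (z + m) * rsv A z i i := by
        intro i; rw [← he2 i]; ring
      simp only [this, Finset.sum_add_distrib, ← Finset.mul_sum]
      have ht : ∑ i, rsv A z i i = m * (n + 1 : ℂ) := by
        rw [hm, div_mul_cancel₀ _ hn0]; rfl
      rw [ht]
      simp
      ring
    have h2 : ‖m ^ 2 + z * m + 1‖ * ((n:ℝ) + 1) ≤ 3 * ε * (2 * (8 / c)) * ((n:ℝ) + 1) := by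
      rw [← hnn, ← norm_mul, h1, hnn]
      refine (norm_sum_le _ _).trans ?_
      refine (Finset.sum_le_sum (g := fun _ => 3 * ε * (2 * (8 / c))) fun j _ => ?_).trans ?_
      · rw [norm_mul, mul_comm]
        exact mul_le_mul (he1 j) (hG j) (norm_nonneg _) ((norm_nonneg _).trans (he1 j))
      · simp; linarith
    exact le_of_mul_le_mul_right h2 hnp
  have hr' : ‖m ^ 2 + z * m + 1‖ ≤ c / 2 := by
    refine hr.trans (le_of_eq ?_)
    rw [hε]; field_simp; norm_num
  have hre : |(m ^ 2 + z * m + 1).re| ≤ c / 2 := (Complex.abs_re_le_norm _).trans hr'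
  have hb0 : 0 ≤ m.im := by
    have : m = ((1 / ((n:ℝ) + 1) : ℝ) : ℂ) * (rsv A z).trace := by
      rw [hm]; push_cast; ring
    rw [this, Complex.im_ofReal_mul]
    have h2 : 0 ≤ (rsv A z).trace.im := by
      rw [Matrix.trace, Complex.im_sum]
      exact Finset.sum_nonneg fun j _ => rsv_im_nonneg hA hz j
    positivity
  have hb : c / 4 ≤ m.im := by
    have h1 : (m ^ 2 + z * m + 1).re = m.re ^ 2 - m.im ^ 2 + z.re * m.re - z.im * m.im + 1 := by
      simp [pow_two]; ring
    rw [h1] at hre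
    have h2 := (abs_le.mp hre).2
    by_contra hcon
    push Not at hcon
    have h3 : z.im * m.im ≤ m.im := by nlinarith
    nlinarith [sq_nonneg (m.re + z.re / 2)]
  have hlow : c / 8 ≤ ‖-z - m + e i‖ := by
    have h1 : ‖z + m‖ - ‖e i‖ ≤ ‖-z - m + e i‖ := by
      have := norm_sub_norm_le (z + m) (e i)
      rwa [← norm_neg (z + m - e i), show -(z + m - e i) = -z - m + e i by ring] at this
    have h2 : m.im ≤ ‖z + m‖ := by
      have := (le_abs_self _).trans (Complex.abs_im_le_norm (z + m))
      rw [Complex.add_im] at this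
      linarith
    have := he1 i
    nlinarith
  have hmul : ‖rsv A z i i‖ * ‖-z - m + e i‖ = 1 := by rw [← norm_mul, he2, norm_one]
  rw [le_div_iff₀ hc]
  nlinarith [norm_nonneg (rsv A z i i)]

lemma boot {n : ℕ} {A : Matrix (Fin (n+1)) (Fin (n+1)) ℂ} (hA : A.IsHermitian) {E : ℝ}
    {c ε : ℝ} (hc : 0 < c) (hc1 : c ≤ 1 - E ^ 2 / 4)
    (hε : ε = c ^ 2 / 96) {η : ℕ → ℝ} (hη : ∀ k, η k = (1 / 2) ^ k) (K : ℕ)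
    (hK : 1 / ((n + 1) * η K) ≤ ε)
    (hd : ∀ i, ‖A i i‖ ≤ ε)
    (hQ : ∀ k ≤ K, ∀ i, 
      ∑ j, ∑ l, ‖rsv (minorM A i) (E + η k * Complex.I) j l‖ ^ 2 ≤
        (n + 1) ^ 2 * ((2 * (8 / c) + 1) / ((n + 1) * η K)) → 
      ‖qdev A (E + η k * Complex.I) i‖ ≤ ε) :
    ∀ k ≤ K, ∀ i, ‖rsv A (E + η k * Complex.I) i i‖ ≤ 8 / c := by
  have hc2 : c ≤ 1 := by nlinarith [sq_nonneg E]
  have hηp : ∀ k, 0 < η k := fun k => by rw [hη]; positivity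
  have hη1 : ∀ k, η k ≤ 1 := fun k => by rw [hη]; exact pow_le_one₀ (by norm_num) (by norm_num)
  have hznim : ∀ k, ((E : ℂ) + η k * Complex.I).im = η k := fun k => by simp
  have hznre : ∀ k, ((E : ℂ) + η k * Complex.I).re = E := fun k => by simp
  have hzp : ∀ k, 0 < ((E : ℂ) + η k * Complex.I).im := fun k => by rw [hznim]; exact hηp k
  have hnp : (0:ℝ) < (n:ℝ) + 1 := by positivity
  intro k
  induction k with
  | zero =>
    intro _ i
    refine (rsv_diag_le hA (hzp 0) i).trans ?_
    rw [hznim, hη, le_div_iff₀ hc]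
    norm_num; linarith
  | succ k ih =>
    intro hk
    have h2 : ∀ i, ‖rsv A (E + η (k+1) * Complex.I) i i‖ ≤ 2 * (8 / c) := by
      intro i
      refine (rsv_double hA (hzp (k+1)) (w := E + η k * Complex.I) ?_ i).trans ?_
      · rw [hznim, hη, hη, pow_succ]; push_cast; ring
      · gcongr; exact ih (by omega) i
    have hmono : η K ≤ η (k+1) := by
      rw [hη, hη]; exact pow_le_pow_of_le_one (by norm_num) (by norm_num) hk
    have hNK : 1 ≤ (n + 1) * η K := by
      have h1 : (1:ℝ) ≤ 1 * ((n + 1) * η K) := by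
        rw [div_le_iff₀ (mul_pos hnp (hηp K))] at hK
        refine hK.trans ?_
        gcongr
        · exact (mul_pos hnp (hηp K)).le
        · rw [hε]; nlinarith
      linarith
    refine boot_step hA (hzp _) (by rw [hznim]; exact hη1 _) hc (by rw [hznre]; exact hc1) hε h2 hd
      ?_ ?_
    · intro i
      apply hQ _ hk
      have h3 := frob_minor hA (hzp (k+1)) i h2
      rw [hznim] at h3
      set S := ∑ j, ∑ l, ‖rsv (minorM A i) (E + η (k+1) * Complex.I) j l‖ ^ 2
      have hS : 0 ≤ S := by positivity
      have h4 : η K * S ≤ (n + 1) * (2 * (8 / c)) + 1 / η K := by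
        calc _ ≤ η (k+1) * S := by gcongr
          _ ≤ _ := h3
          _ ≤ _ := by gcongr; exact hηp K
      have h5 : 1 / η K ≤ n + 1 := by rw [div_le_iff₀ (hηp K)]; exact hNK
      have h6 : (n + 1 : ℝ) ^ 2 * ((2 * (8 / c) + 1) / ((n + 1) * η K)) =
          ((n + 1) * (2 * (8 / c) + 1)) / η K := by
        have := hηp K
        field_simp
      rw [h6, le_div_iff₀ (hηp K)]
      linarith
    · refine le_trans ?_ hK
      rw [hznim]
      have := hηp K
      gcongr


structure SubG (μ : Measure ℂ) (δ D : ℝ) : Prop where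
  prob : IsProbabilityMeasure μ
  pos : 0 < δ
  mean : ∫ z, z ∂μ = 0
  var : ∫ z, ‖z‖ ^ 2 ∂μ = 1
  mom : (∫⁻ z, ENNReal.ofReal (Real.exp (δ * ‖z‖ ^ 2)) ∂μ) ≤ ENNReal.ofReal D

lemma SubG.int_exp {μ : Measure ℂ} {δ D : ℝ} (h : SubG μ δ D) :
    Integrable (fun z => Real.exp (δ * ‖z‖ ^ 2)) μ := by
  refine ⟨by fun_prop, ?_⟩
  rw [hasFiniteIntegral_iff_ofReal (Filter.Eventually.of_forall fun z => (Real.exp_pos _).le)]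
  exact h.mom.trans_lt ENNReal.ofReal_lt_top

lemma SubG.one_le {μ : Measure ℂ} {δ D : ℝ} (h : SubG μ δ D) : 1 ≤ D := by
  have := h.prob
  have h1 : (1 : ℝ≥0∞) ≤ ENNReal.ofReal D := by
    refine le_trans ?_ h.mom
    calc (1 : ℝ≥0∞) = ∫⁻ z, 1 ∂μ := by simp
      _ ≤ _ := lintegral_mono fun z => by
        rw [ENNReal.one_le_ofReal]
        exact Real.one_le_exp (by have := h.pos; positivity)
  rwa [ENNReal.one_le_ofReal] at h1

lemma SubG.integral_exp_le {μ : Measure ℂ} {δ D : ℝ} (h : SubG μ δ D) :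
    ∫ z, Real.exp (δ * ‖z‖ ^ 2) ∂μ ≤ D := by
  have h1 := h.mom
  rw [← ofReal_integral_eq_lintegral_ofReal h.int_exp
    (Filter.Eventually.of_forall fun z => (Real.exp_pos _).le)] at h1
  exact (ENNReal.ofReal_le_ofReal_iff (by linarith [h.one_le])).mp h1

lemma SubG.int_sq {μ : Measure ℂ} {δ D : ℝ} (h : SubG μ δ D) :
    Integrable (fun z : ℂ => ‖z‖ ^ 2) μ := by
  by_contra hc
  have := h.var
  rw [integral_undef hc] at this
  norm_num at this

lemma SubG.int_id {μ : Measure ℂ} {δ D : ℝ} (h : SubG μ δ D) :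
    Integrable (fun z : ℂ => z) μ := by
  have := h.prob
  refine Integrable.mono' (h.int_sq.add (integrable_const (1:ℝ))) (by fun_prop)
    (Filter.Eventually.of_forall fun z => ?_)
  simp only [Pi.add_apply]
  nlinarith [sq_nonneg (‖z‖ - 1), norm_nonneg z]

lemma exp_le_quad (y : ℝ) : Real.exp y ≤ 1 + y + y ^ 2 * Real.exp |y| := by
  have h := Complex.norm_exp_sub_sum_le_norm_mul_exp (y : ℂ) 2
  simp only [Finset.sum_range_succ, Finset.sum_range_zero] at h
  have e : Complex.exp (y:ℂ) - (0 + (y:ℂ) ^ 0 / (Nat.factorial 0 : ℕ) + (y:ℂ) ^ 1 / (Nat.factorial 1 : ℕ)) =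
      ((Real.exp y - (1 + y) : ℝ) : ℂ) := by simp
  rw [e, Complex.norm_real, Complex.norm_real, Real.norm_eq_abs, Real.norm_eq_abs, sq_abs] at h
  linarith [(abs_le.mp h).2]

/-- the constant in the exponential moment bound -/
def KK (δ D : ℝ) : ℝ := 16 / δ ^ 2 * Real.exp (1 + δ) * D + (D / δ + 1 / (2 * δ) + 1 / 4)

lemma SubG.step {μ : Measure ℂ} {δ D : ℝ} (h : SubG μ δ D) (L : ℂ) (a : ℝ) (ha : |a| ≤ δ / 4) :
    ∫⁻ z, ENNReal.ofReal (Real.exp ((star z * L).re + a * (‖z‖ ^ 2 - 1))) ∂μ ≤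
      ENNReal.ofReal (Real.exp (KK δ D * (‖L‖ ^ 2 + a ^ 2))) := by
  have hp := h.prob
  have hδ := h.pos
  have hD := h.one_le
  have hK1 : 0 ≤ 16 / δ ^ 2 * Real.exp (1 + δ) * D := by positivity
  have hK2 : 0 ≤ D / δ + 1 / (2 * δ) + 1 / 4 := by positivity
  have hre : ∀ z : ℂ, |(star z * L).re| ≤ ‖z‖ * ‖L‖ := fun z => by
    refine (Complex.abs_re_le_norm _).trans ?_
    rw [norm_mul, norm_star]
  have hab : ∀ z : ℂ, |a * (‖z‖ ^ 2 - 1)| ≤ |a| * (‖z‖ ^ 2 + 1) := fun z => by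
    rw [abs_mul]; gcongr
    rw [abs_le]; constructor <;> nlinarith [sq_nonneg ‖z‖]
  rcases le_total (‖L‖ ^ 2) δ with hL | hL
  · -- small case
    set T := 16 / δ ^ 2 * Real.exp (1 + δ) * (‖L‖ ^ 2 + a ^ 2) with hT
    have hT0 : 0 ≤ T := by positivity
    have hpt : ∀ z : ℂ, Real.exp ((star z * L).re + a * (‖z‖ ^ 2 - 1)) ≤
        1 + ((star z * L).re + a * (‖z‖ ^ 2 - 1)) + T * Real.exp (δ * ‖z‖ ^ 2) := by
      intro z
      refine (exp_le_quad _).trans ?_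
      gcongr 1 + _ + ?_
      set y1 := (star z * L).re
      set y2 := a * (‖z‖ ^ 2 - 1)
      set t := ‖z‖ ^ 2 with ht
      have ht0 : 0 ≤ t := by positivity
      have hy1 := hre z
      have hy2 := hab z
      have hzL : ‖z‖ * ‖L‖ ≤ δ / 4 * t + 1 := by
        have h1 : ‖z‖ * ‖L‖ ≤ δ / 4 * t + ‖L‖ ^ 2 / δ := by
          have : δ / 4 * t + ‖L‖ ^ 2 / δ - ‖z‖ * ‖L‖ = (δ / 2 * ‖z‖ - ‖L‖) ^ 2 / δ := by
            rw [ht]; field_simp; ring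
          have h2 : 0 ≤ (δ / 2 * ‖z‖ - ‖L‖) ^ 2 / δ := by positivity
          linarith
        have h3 : ‖L‖ ^ 2 / δ ≤ 1 := by rw [div_le_one hδ]; exact hL
        linarith
      have habs : |y1 + y2| ≤ δ / 2 * t + 1 + δ / 4 := by
        refine (abs_add_le _ _).trans ?_
        have : |a| * (t + 1) ≤ δ / 4 * (t + 1) := by gcongr
        linarith
      have hexp : (t + 1) ^ 2 ≤ 8 / δ ^ 2 * Real.exp (δ / 2 * (t + 1)) := by
        have h1 := Real.quadratic_le_exp_of_nonneg (x := δ / 2 * (t + 1)) (by positivity)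
        have h2 : (δ / 2 * (t + 1)) ^ 2 / 2 ≤ Real.exp (δ / 2 * (t + 1)) := by
          have : 0 ≤ δ / 2 * (t + 1) := by positivity
          linarith
        calc (t + 1) ^ 2 = 8 / δ ^ 2 * ((δ / 2 * (t + 1)) ^ 2 / 2) := by field_simp; ring
          _ ≤ _ := by gcongr
      have hsq : (y1 + y2) ^ 2 ≤ 2 * (‖L‖ ^ 2 + a ^ 2) * (t + 1) ^ 2 := by
        have s1 : y1 ^ 2 ≤ t * ‖L‖ ^ 2 := by
          rw [ht, ← mul_pow, ← sq_abs]; gcongr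
        have s2 : y2 ^ 2 ≤ a ^ 2 * (t + 1) ^ 2 := by
          rw [← sq_abs y2, ← sq_abs a, ← mul_pow]; gcongr
        have s3 : t * ‖L‖ ^ 2 ≤ (t + 1) ^ 2 * ‖L‖ ^ 2 := by gcongr; nlinarith
        nlinarith [sq_nonneg (y1 - y2)]
      calc (y1 + y2) ^ 2 * Real.exp |y1 + y2| 
          ≤ (2 * (‖L‖ ^ 2 + a ^ 2) * (8 / δ ^ 2 * Real.exp (δ / 2 * (t + 1)))) *
              Real.exp (δ / 2 * t + 1 + δ / 4) := by
            gcongr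
            exact hsq.trans (by gcongr)
        _ = 16 / δ ^ 2 * (‖L‖ ^ 2 + a ^ 2) * Real.exp (δ / 2 * (t + 1) + (δ / 2 * t + 1 + δ / 4)) := by
            rw [Real.exp_add (δ / 2 * (t + 1))]; ring
        _ ≤ 16 / δ ^ 2 * (‖L‖ ^ 2 + a ^ 2) * Real.exp ((1 + δ) + δ * t) := by
            refine mul_le_mul_of_nonneg_left (Real.exp_le_exp.mpr ?_) (by positivity)
            nlinarith
        _ = T * Real.exp (δ * t) := by rw [hT, Real.exp_add (1 + δ)]; ring
    have i1 : Integrable (fun z : ℂ => (star z * L).re) μ := by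
      have : Integrable (fun z : ℂ => star z * L) μ := by
        refine Integrable.mono' (h.int_id.norm.mul_const ‖L‖) (by fun_prop)
          (Filter.Eventually.of_forall fun z => ?_)
        rw [norm_mul, norm_star]
      exact this.re
    have i2 : Integrable (fun z : ℂ => a * (‖z‖ ^ 2 - 1)) μ :=
      (h.int_sq.sub (integrable_const 1)).const_mul a
    have e1 : ∫ z, (star z * L).re ∂μ = 0 := by
      have e : ∀ z : ℂ, (star z * L).re = (star L * z).re := by
        intro z; simp; ring
      simp_rw [e]
      have := integral_re (μ := μ) (𝕜 := ℂ) (h.int_id.const_mul (star L))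
      rw [integral_const_mul, h.mean] at this
      simpa using this
    have e2 : ∫ z, a * (‖z‖ ^ 2 - 1) ∂μ = 0 := by
      rw [integral_const_mul, integral_sub h.int_sq (integrable_const 1), h.var]; simp
    have i3 : Integrable (fun z : ℂ => 1 + ((star z * L).re + a * (‖z‖ ^ 2 - 1)) +
        T * Real.exp (δ * ‖z‖ ^ 2)) μ :=
      ((integrable_const 1).add (i1.add i2)).add (h.int_exp.const_mul T)
    calc _ ≤ ∫⁻ z, ENNReal.ofReal (1 + ((star z * L).re + a * (‖z‖ ^ 2 - 1)) +
        T * Real.exp (δ * ‖z‖ ^ 2)) ∂μ :=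
          lintegral_mono fun z => ENNReal.ofReal_le_ofReal (hpt z)
      _ = ENNReal.ofReal (∫ z, (1 + ((star z * L).re + a * (‖z‖ ^ 2 - 1)) +
        T * Real.exp (δ * ‖z‖ ^ 2)) ∂μ) := by
          rw [ofReal_integral_eq_lintegral_ofReal i3
            (Filter.Eventually.of_forall fun z => (Real.exp_pos _).le.trans (hpt z))]
      _ ≤ _ := by
          apply ENNReal.ofReal_le_ofReal
          have i12 : Integrable (fun z : ℂ => (star z * L).re + a * (‖z‖ ^ 2 - 1)) μ := i1.add i2
          have i0 : Integrable (fun z : ℂ => 1 + ((star z * L).re + a * (‖z‖ ^ 2 - 1))) μ :=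
            (integrable_const 1).add i12
          rw [integral_add i0 (h.int_exp.const_mul T),
            integral_add (integrable_const 1) i12, integral_add i1 i2, e1, e2,
            integral_const_mul]
          simp only [integral_const, probReal_univ, smul_eq_mul, one_mul, add_zero]
          have hi := h.integral_exp_le
          have : T * ∫ z, Real.exp (δ * ‖z‖ ^ 2) ∂μ ≤ KK δ D * (‖L‖ ^ 2 + a ^ 2) := by
            calc _ ≤ T * D := by gcongr
              _ = 16 / δ ^ 2 * Real.exp (1 + δ) * D * (‖L‖ ^ 2 + a ^ 2) := by rw [hT]; ring
              _ ≤ _ := by rw [KK]; gcongr; linarith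
          refine le_trans ?_ (Real.add_one_le_exp _)
          linarith
  · have hpt : ∀ z : ℂ, Real.exp ((star z * L).re + a * (‖z‖ ^ 2 - 1)) ≤
        Real.exp (‖L‖ ^ 2 / (2 * δ) + δ / 4) * Real.exp (δ * ‖z‖ ^ 2) := by
      intro z
      rw [← Real.exp_add]
      refine Real.exp_le_exp.mpr ?_
      have h1 := (le_abs_self _).trans (hre z)
      have h2 := (le_abs_self _).trans (hab z)
      have h3 : |a| * (‖z‖ ^ 2 + 1) ≤ δ / 4 * (‖z‖ ^ 2 + 1) := by gcongr
      have h4 : ‖z‖ * ‖L‖ ≤ δ / 2 * ‖z‖ ^ 2 + ‖L‖ ^ 2 / (2 * δ) := by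
        have : δ / 2 * ‖z‖ ^ 2 + ‖L‖ ^ 2 / (2 * δ) - ‖z‖ * ‖L‖ = (δ * ‖z‖ - ‖L‖) ^ 2 / (2 * δ) := by
          field_simp; ring
        have h2 : 0 ≤ (δ * ‖z‖ - ‖L‖) ^ 2 / (2 * δ) := by positivity
        linarith
      nlinarith [sq_nonneg ‖z‖]
    calc _ ≤ ∫⁻ z, ENNReal.ofReal (Real.exp (‖L‖ ^ 2 / (2 * δ) + δ / 4)) *
          ENNReal.ofReal (Real.exp (δ * ‖z‖ ^ 2)) ∂μ :=
          lintegral_mono fun z => by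
            rw [← ENNReal.ofReal_mul (Real.exp_pos _).le]
            exact ENNReal.ofReal_le_ofReal (hpt z)
      _ ≤ ENNReal.ofReal (Real.exp (‖L‖ ^ 2 / (2 * δ) + δ / 4)) * ENNReal.ofReal D := by
          rw [lintegral_const_mul _ (by fun_prop)]
          gcongr
          exact h.mom
      _ ≤ _ := by
          rw [← ENNReal.ofReal_mul (Real.exp_pos _).le]
          apply ENNReal.ofReal_le_ofReal
          have hDe : D ≤ Real.exp D := by linarith [Real.add_one_le_exp D]
          calc _ ≤ Real.exp (‖L‖ ^ 2 / (2 * δ) + δ / 4) * Real.exp D := by gcongr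
            _ = Real.exp (‖L‖ ^ 2 / (2 * δ) + δ / 4 + D) := by rw [← Real.exp_add]
            _ ≤ _ := by
              gcongr
              have h1 : D ≤ D / δ * ‖L‖ ^ 2 := by
                rw [div_mul_eq_mul_div, le_div_iff₀ hδ]; gcongr
              calc _ ≤ (D / δ + 1 / (2 * δ) + 1 / 4) * ‖L‖ ^ 2 := by
                    have : ‖L‖ ^ 2 / (2 * δ) = 1 / (2 * δ) * ‖L‖ ^ 2 := by ring
                    rw [this]; nlinarith
                _ ≤ _ := by
                    rw [KK]
                    have : 0 ≤ a ^ 2 := by positivity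
                    nlinarith [mul_nonneg hK1 (sq_nonneg ‖L‖), mul_nonneg hK1 this, mul_nonneg hK2 this]

/-- the partial linear forms -/
def linf {n : ℕ} (A : Matrix (Fin n) (Fin n) ℂ) (b : Fin n → ℂ) (x : Fin n → ℂ) (k : Fin n) : ℂ :=
  b k + ∑ j, if j < k then A k j * x j else 0

lemma multi {δ D : ℝ} : ∀ (n : ℕ) (μ : Fin n → Measure ℂ) (_ : ∀ j, SubG (μ j) δ D)
    (A : Matrix (Fin n) (Fin n) ℂ) (b : Fin n → ℂ) (a : Fin n → ℝ) (_ : ∀ k, |a k| ≤ δ / 4),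
    ∫⁻ x, ENNReal.ofReal (Real.exp (∑ k, ((star (x k) * linf A b x k).re + a k * (‖x k‖ ^ 2 - 1) -
      KK δ D * (‖linf A b x k‖ ^ 2 + a k ^ 2)))) ∂(Measure.pi μ) ≤ 1 := by
  intro n
  induction n with
  | zero =>
    intro μ hμ A b a ha
    simp
  | succ n ih =>
    intro μ hμ A b a ha
    have hpr : ∀ j, IsProbabilityMeasure (μ j) := fun j => (hμ j).prob
    have hmp := (measurePreserving_piFinSuccAbove μ (Fin.last n)).symm
    have hmeas : Measurable fun x : Fin (n+1) → ℂ => ENNReal.ofReal (Real.exp (∑ k, ((star (x k) * linf A b x k).re + a k * (‖x k‖ ^ 2 - 1) -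
      KK δ D * (‖linf A b x k‖ ^ 2 + a k ^ 2)))) := by
      have : ∀ k, Measurable fun x : Fin (n+1) → ℂ => linf A b x k := by
        intro k
        unfold linf
        refine measurable_const.add (Finset.measurable_fun_sum _ fun j _ => ?_)
        split_ifs <;> fun_prop
      refine (Real.measurable_exp.comp (Finset.measurable_fun_sum _ fun k _ => ?_)).ennreal_ofReal
      have hk : ∀ f : (Fin (n+1) → ℂ) → ℂ, Measurable f → Measurable fun x : Fin (n+1) → ℂ =>
          (star (x k) * f x).re + a k * (‖x k‖ ^ 2 - 1) - KK δ D * (‖f x‖ ^ 2 + a k ^ 2) := by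
        intro f hf
        fun_prop
      exact hk _ (this k)
    rw [← hmp.lintegral_comp hmeas]
    have hmeas2 := hmeas.comp (MeasurableEquiv.piFinSuccAbove (fun _ : Fin (n+1) => ℂ) (Fin.last n)).symm.measurable
    refine le_trans (lintegral_prod_symm _ hmeas2.aemeasurable).le ?_
    refine le_trans (lintegral_mono (g := fun y : Fin n → ℂ => 
      ENNReal.ofReal (Real.exp (∑ k, ((star (y k) * linf (A.submatrix Fin.castSucc Fin.castSucc) (b ∘ Fin.castSucc) y k).re + a k.castSucc * (‖y k‖ ^ 2 - 1) -
      KK δ D * (‖linf (A.submatrix Fin.castSucc Fin.castSucc) (b ∘ Fin.castSucc) y k‖ ^ 2 + a k.castSucc ^ 2))))) fun y => ?_) ?_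
    · set L : ℂ := b (Fin.last n) + ∑ j : Fin n, A (Fin.last n) j.castSucc * y j with hLdef
      have hins : ∀ z : ℂ, (MeasurableEquiv.piFinSuccAbove (fun _ : Fin (n+1) => ℂ) (Fin.last n)).symm (z, y) = Fin.snoc (α := fun _ => ℂ) y z := by
        intro z
        rw [← Fin.insertNth_last']
        rfl
      have hl1 : ∀ z : ℂ, linf A b (Fin.snoc (α := fun _ => ℂ) y z) (Fin.last n) = L := by
        intro z
        rw [linf, Fin.sum_univ_castSucc]
        simp [Fin.castSucc_lt_last, hLdef]
      have hl2 : ∀ (z : ℂ) (k : Fin n), linf A b (Fin.snoc (α := fun _ => ℂ) y z) k.castSucc =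
          linf (A.submatrix Fin.castSucc Fin.castSucc) (b ∘ Fin.castSucc) y k := by
        intro z k
        rw [linf, Fin.sum_univ_castSucc, linf]
        simp [not_lt.mpr (Fin.castSucc_lt_last k).le]
      simp only [Function.comp_apply, hins, Fin.sum_univ_castSucc, hl1, hl2, Fin.snoc_castSucc, Fin.snoc_last]
      set S := ∑ k, ((star (y k) * linf (A.submatrix Fin.castSucc Fin.castSucc) (b ∘ Fin.castSucc) y k).re + a k.castSucc * (‖y k‖ ^ 2 - 1) -
        KK δ D * (‖linf (A.submatrix Fin.castSucc Fin.castSucc) (b ∘ Fin.castSucc) y k‖ ^ 2 + a k.castSucc ^ 2))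
      have heq : ∀ z : ℂ, ENNReal.ofReal (Real.exp (S + ((star z * L).re + a (Fin.last n) * (‖z‖ ^ 2 - 1) -
          KK δ D * (‖L‖ ^ 2 + a (Fin.last n) ^ 2)))) =
          ENNReal.ofReal (Real.exp (S - KK δ D * (‖L‖ ^ 2 + a (Fin.last n) ^ 2))) *
          ENNReal.ofReal (Real.exp ((star z * L).re + a (Fin.last n) * (‖z‖ ^ 2 - 1))) := by
        intro z
        rw [← ENNReal.ofReal_mul (Real.exp_pos _).le, ← Real.exp_add]
        congr 2; ring
      simp only [heq]
      rw [lintegral_const_mul _ (by fun_prop)]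
      refine (mul_le_mul_right ((hμ (Fin.last n)).step L _ (ha _)) _).trans ?_
      rw [← ENNReal.ofReal_mul (Real.exp_pos _).le, ← Real.exp_add]
      apply ENNReal.ofReal_le_ofReal
      gcongr
      linarith
    · have := ih (fun j => μ ((Fin.last n).succAbove j)) (fun j => hμ _) (A.submatrix Fin.castSucc Fin.castSucc)
        (b ∘ Fin.castSucc) (a ∘ Fin.castSucc) (fun k => ha _)
      exact this


lemma measurable_linf {n : ℕ} (A : Matrix (Fin n) (Fin n) ℂ) (b : Fin n → ℂ) (k : Fin n) :
    Measurable fun x : Fin n → ℂ => linf A b x k := by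
  unfold linf
  refine measurable_const.add (Finset.measurable_fun_sum _ fun j _ => ?_)
  split_ifs <;> fun_prop

lemma multi_tail {δ D : ℝ} {n : ℕ} {μ : Fin n → Measure ℂ} (hμ : ∀ j, SubG (μ j) δ D)
    (A : Matrix (Fin n) (Fin n) ℂ) (b : Fin n → ℂ) (a : Fin n → ℝ) (ha : ∀ k, |a k| ≤ δ / 4)
    (r : ℝ) :
    Measure.pi μ {x | r ≤ ∑ k, ((star (x k) * linf A b x k).re + a k * (‖x k‖ ^ 2 - 1) -
      KK δ D * (‖linf A b x k‖ ^ 2 + a k ^ 2))} ≤ ENNReal.ofReal (Real.exp (-r)) := by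
  have h := multi n μ hμ A b a ha
  have hmeas : Measurable fun x : Fin n → ℂ => ENNReal.ofReal (Real.exp
      (∑ k, ((star (x k) * linf A b x k).re + a k * (‖x k‖ ^ 2 - 1) -
      KK δ D * (‖linf A b x k‖ ^ 2 + a k ^ 2)))) := by
    refine (Real.measurable_exp.comp (Finset.measurable_fun_sum _ fun k _ => ?_)).ennreal_ofReal
    have hk : ∀ f : (Fin n → ℂ) → ℂ, Measurable f → Measurable fun x : Fin n → ℂ =>
          (star (x k) * f x).re + a k * (‖x k‖ ^ 2 - 1) - KK δ D * (‖f x‖ ^ 2 + a k ^ 2) := by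
      intro f hf
      fun_prop
    exact hk _ (measurable_linf A b k)
  have h2 := mul_meas_ge_le_lintegral₀ (μ := Measure.pi μ) hmeas.aemeasurable
    (ENNReal.ofReal (Real.exp r))
  have h3 := h2.trans h
  have he : ENNReal.ofReal (Real.exp (-r)) = (ENNReal.ofReal (Real.exp r))⁻¹ := by
    rw [Real.exp_neg, ENNReal.ofReal_inv_of_pos (Real.exp_pos _)]
  rw [he, ENNReal.le_inv_iff_mul_le, mul_comm]
  refine le_trans ?_ h3
  gcongr
  exact fun h => ENNReal.ofReal_le_ofReal (Real.exp_le_exp.mpr h)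

lemma KK_pos {δ D : ℝ} (hδ : 0 < δ) (hD : 1 ≤ D) : 0 < KK δ D := by
  unfold KK; positivity

lemma lin_dir {δ D : ℝ} {n : ℕ} {μ : Fin n → Measure ℂ} (hμ : ∀ j, SubG (μ j) δ D) (hδ : 0 < δ)
    (b : Fin n → ℂ) (r : ℝ) :
    Measure.pi μ {x | r ≤ (∑ j, b j * x j).re} ≤
      ENNReal.ofReal (Real.exp (-r + KK δ D * ∑ j, ‖b j‖ ^ 2)) := by
  have h := multi_tail hμ 0 (fun j => star (b j)) 0 (fun k => by simp; positivity)
    (r - KK δ D * ∑ j, ‖b j‖ ^ 2)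
  rw [show -(r - KK δ D * ∑ j, ‖b j‖ ^ 2) = -r + KK δ D * ∑ j, ‖b j‖ ^ 2 by ring] at h
  refine le_trans (measure_mono fun x hx => ?_) h
  simp only [Set.mem_setOf_eq] at hx ⊢
  rw [Finset.sum_sub_distrib, ← Finset.mul_sum]
  simp only [linf, Matrix.zero_apply, zero_mul, ite_self, Finset.sum_const_zero, add_zero,
    Pi.zero_apply, norm_star, ne_eq, OfNat.ofNat_ne_zero, not_false_eq_true, zero_pow]
  rw [Complex.re_sum] at hx
  have : ∀ k, (star (x k) * star (b k)).re = (b k * x k).re := by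
    intro k; simp; ring
  simp only [this]
  linarith

lemma dir4 {r : ℝ} {w : ℂ} (h : 2 * r ≤ ‖w‖) : ∃ m : Fin 4, r ≤ (Complex.I ^ (m : ℕ) * w).re := by
  by_contra hc
  push Not at hc
  have h0 := hc 0
  have h1 := hc 1
  have h2 := hc 2
  have h3 := hc 3
  simp [pow_succ] at h0 h1 h2 h3
  have h4 := Complex.norm_le_abs_re_add_abs_im w
  have : |w.re| < r := abs_lt.mpr ⟨by linarith, by linarith⟩
  have : |w.im| < r := abs_lt.mpr ⟨by linarith, by linarith⟩
  linarith

lemma lin_tail {δ D : ℝ} {n : ℕ} {μ : Fin n → Measure ℂ} (hμ : ∀ j, SubG (μ j) δ D) (hδ : 0 < δ)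
    (hD : 1 ≤ D) (b : Fin n → ℂ) {s : ℝ} (hs : 0 < s) :
    Measure.pi μ {x | s * ∑ j, ‖b j‖ ^ 2 < ‖∑ j, b j * x j‖ ^ 2} ≤
      4 * ENNReal.ofReal (Real.exp (-(s / (16 * KK δ D)))) := by
  have hK := KK_pos hδ hD
  set K := KK δ D
  set β := ∑ j, ‖b j‖ ^ 2 with hβ
  have hβ0 : 0 ≤ β := by positivity
  rcases hβ0.eq_or_lt with h0 | hpos
  · have hb : ∀ j, b j = 0 := by
      intro j
      have := (Finset.sum_eq_zero_iff_of_nonneg (fun j _ => by positivity)).mp h0.symm j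
        (Finset.mem_univ j)
      simpa using this
    have : {x : Fin n → ℂ | s * β < ‖∑ j, b j * x j‖ ^ 2} = ∅ := by
      ext x; simp [hb, ← h0]
    rw [this]; simp
  · set l := Real.sqrt (s / β) / (4 * K) with hl
    have hl0 : 0 < l := by positivity
    have hl2 : l ^ 2 = s / β / (16 * K ^ 2) := by
      rw [hl, div_pow, Real.sq_sqrt (by positivity)]; ring
    have hsub : {x : Fin n → ℂ | s * β < ‖∑ j, b j * x j‖ ^ 2} ⊆
        ⋃ m : Fin 4, {x | s / (8 * K) ≤ (∑ j, ((l : ℂ) * Complex.I ^ (m:ℕ) * b j) * x j).re} := by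
      intro x hx
      simp only [Set.mem_setOf_eq] at hx
      have h1 : Real.sqrt (s * β) ≤ ‖∑ j, b j * x j‖ := by
        rw [← Real.sqrt_sq (norm_nonneg (∑ j, b j * x j))]
        exact Real.sqrt_le_sqrt hx.le
      obtain ⟨m, hm⟩ := dir4 (r := Real.sqrt (s * β) / 2) (w := ∑ j, b j * x j) (by linarith)
      refine Set.mem_iUnion.mpr ⟨m, ?_⟩
      simp only [Set.mem_setOf_eq, mul_assoc]
      rw [← Finset.mul_sum, ← Finset.mul_sum, Complex.re_ofReal_mul]
      have h2 : l * (Real.sqrt (s * β) / 2) = s / (8 * K) := by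
        have : Real.sqrt (s / β) * Real.sqrt (s * β) = s := by
          rw [← Real.sqrt_mul (by positivity), show s / β * (s * β) = s ^ 2 by field_simp,
            Real.sqrt_sq hs.le]
        rw [hl]
        calc _ = Real.sqrt (s / β) * Real.sqrt (s * β) / (8 * K) := by field_simp; ring
          _ = _ := by rw [this]
      rw [← h2]
      gcongr
    refine (measure_mono hsub).trans ((measure_iUnion_le _).trans ?_)
    rw [tsum_fintype]
    refine (Finset.sum_le_sum (g := fun _ => ENNReal.ofReal (Real.exp (-(s / (16 * K)))))
      fun m _ => ?_).trans (by simp)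
    refine (lin_dir hμ hδ _ _).trans (ENNReal.ofReal_le_ofReal (Real.exp_le_exp.mpr ?_))
    have : ∀ j, ‖(l : ℂ) * Complex.I ^ (m:ℕ) * b j‖ ^ 2 = l ^ 2 * ‖b j‖ ^ 2 := by
      intro j; simp [mul_pow]
    simp only [this, ← Finset.mul_sum]
    rw [← hβ, hl2]
    apply le_of_eq
    change -(s / (8 * K)) + K * (s / β / (16 * K ^ 2) * β) = _
    field_simp
    norm_num

lemma sum_split {n : ℕ} (t : Fin n → Fin n → ℝ) :
    ∑ k, ∑ j, t k j = ∑ k, (t k k + ∑ j, if j < k then t k j + t j k else 0) := by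
  have h1 : ∑ k, ∑ j, (if j < k then t j k else 0) = ∑ k, ∑ j, (if k < j then t k j else 0) :=
    Finset.sum_comm
  have h2 : ∀ k j, (if j < k then t k j + t j k else 0) =
      (if j < k then t k j else 0) + (if j < k then t j k else 0) := by
    intro k j; split_ifs <;> simp
  simp only [h2, Finset.sum_add_distrib, h1]
  rw [← Finset.sum_add_distrib, ← Finset.sum_add_distrib]
  refine Finset.sum_congr rfl fun k _ => ?_
  have h3 : t k k = ∑ j, if j = k then t k j else 0 := by simp
  rw [h3, ← Finset.sum_add_distrib, ← Finset.sum_add_distrib]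
  refine Finset.sum_congr rfl fun j _ => ?_
  rcases lt_trichotomy j k with h | h | h
  · simp [h, h.ne, h.not_gt]
  · simp [h]
  · simp [h, h.ne', h.not_gt]

lemma quad_dir {δ D : ℝ} {n : ℕ} {μ : Fin n → Measure ℂ} (hμ : ∀ j, SubG (μ j) δ D) (hδ : 0 < δ)
    (hD : 1 ≤ D) (A : Matrix (Fin n) (Fin n) ℂ) {F l s : ℝ} (hF : ∑ j, ∑ k, ‖A j k‖ ^ 2 ≤ F)
    (hl : 0 < l) (hlF : l ^ 2 * F ≤ (δ / 4) ^ 2) (hs : 0 < s) (r : ℝ) :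
    Measure.pi μ {x | r ≤ (qf A x - A.trace).re} ≤
      ENNReal.ofReal (Real.exp (-(l * r) + KK δ D * (l ^ 2 * F * (4 * s + 1)))) +
        n * (4 * ENNReal.ofReal (Real.exp (-(s / (16 * KK δ D))))) := by
  have hK := KK_pos hδ hD
  have hKd : KK δ D = KK δ D := rfl
  set B : Matrix (Fin n) (Fin n) ℂ := fun k j => (l : ℂ) * (A k j + star (A j k)) with hB
  set a : Fin n → ℝ := fun k => l * (A k k).re with ha
  have hAkk : ∀ k, ‖A k k‖ ^ 2 ≤ F := by
    intro k
    refine le_trans ?_ hF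
    refine le_trans ?_ (Finset.single_le_sum (f := fun j => ∑ k, ‖A j k‖ ^ 2)
      (fun j _ => by positivity) (Finset.mem_univ k))
    exact Finset.single_le_sum (f := fun j => ‖A k j‖ ^ 2)
      (fun j _ => by positivity) (Finset.mem_univ k)
  have ha1 : ∀ k, |a k| ≤ δ / 4 := by
    intro k
    apply abs_le_of_sq_le_sq _ (by positivity)
    refine le_trans ?_ hlF
    rw [ha]; simp only [mul_pow]
    gcongr
    refine le_trans ?_ (hAkk k)
    rw [← sq_abs (A k k).re]
    gcongr
    exact Complex.abs_re_le_norm _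
  have hid : ∀ x : Fin n → ℂ, l * (qf A x - A.trace).re =
      ∑ k, ((star (x k) * linf B 0 x k).re + a k * (‖x k‖ ^ 2 - 1)) := by
    intro x
    have h1 : (qf A x).re = ∑ k, ∑ j, (star (x k) * A k j * x j).re := by
      rw [qf, Complex.re_sum]
      exact Finset.sum_congr rfl fun k _ => by rw [Complex.re_sum]
    have h2 : A.trace.re = ∑ k, (A k k).re := by rw [Matrix.trace, Complex.re_sum]; rfl
    rw [Complex.sub_re, h1, h2, sum_split, ← Finset.sum_sub_distrib, Finset.mul_sum]
    refine Finset.sum_congr rfl fun k _ => ?_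
    have h3 : (star (x k) * A k k * x k).re = (A k k).re * ‖x k‖ ^ 2 := by
      rw [← Complex.normSq_eq_norm_sq, Complex.normSq_apply]
      simp; ring
    have h4 : (star (x k) * linf B 0 x k).re =
        l * ∑ j, if j < k then (star (x k) * A k j * x j).re + (star (x j) * A j k * x k).re else 0 := by
      rw [linf, Pi.zero_apply, zero_add, Finset.mul_sum, Complex.re_sum, Finset.mul_sum]
      refine Finset.sum_congr rfl fun j _ => ?_
      split_ifs
      · simp [hB]; ring
      · simp
    rw [h3, h4, ha]; ring
  have hlin : ∀ x k, linf B 0 x k = ∑ j, (if j < k then B k j else 0) * x j := by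
    intro x k
    rw [linf, Pi.zero_apply, zero_add]
    refine Finset.sum_congr rfl fun j _ => ?_
    split_ifs <;> simp
  have hBF : ∑ k, ∑ j, ‖(if j < k then B k j else 0)‖ ^ 2 ≤ l ^ 2 * (4 * F) := by
    have h1 : ∀ k j, ‖(if j < k then B k j else 0)‖ ^ 2 ≤ l ^ 2 * (2 * ‖A k j‖ ^ 2 + 2 * ‖A j k‖ ^ 2) := by
      intro k j
      split_ifs
      · rw [hB]
        simp only [norm_mul, mul_pow, Complex.norm_real, Real.norm_eq_abs, sq_abs]
        gcongr
        have h2 := norm_add_le (A k j) (star (A j k))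
        rw [norm_star] at h2
        have h3 := norm_nonneg (A k j + star (A j k))
        nlinarith [sq_nonneg (‖A k j‖ - ‖A j k‖)]
      · simp; positivity
    refine (Finset.sum_le_sum fun k _ => Finset.sum_le_sum fun j _ => h1 k j).trans ?_
    simp only [← Finset.mul_sum, Finset.sum_add_distrib]
    gcongr
    have : ∑ k, ∑ j, ‖A j k‖ ^ 2 = ∑ j, ∑ k, ‖A j k‖ ^ 2 := Finset.sum_comm
    rw [this]
    linarith
  have haF : ∑ k, a k ^ 2 ≤ l ^ 2 * F := by
    calc ∑ k, a k ^ 2 ≤ ∑ k, l ^ 2 * ∑ j, ‖A k j‖ ^ 2 := by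
          refine Finset.sum_le_sum fun k _ => ?_
          rw [ha]; simp only [mul_pow]
          gcongr
          refine le_trans ?_ (Finset.single_le_sum (f := fun j => ‖A k j‖ ^ 2)
            (fun j _ => by positivity) (Finset.mem_univ k))
          rw [← sq_abs (A k k).re]
          gcongr
          exact Complex.abs_re_le_norm _
      _ ≤ _ := by rw [← Finset.mul_sum]; gcongr
  have hsub : {x : Fin n → ℂ | r ≤ (qf A x - A.trace).re} ⊆
      {x | l * r - KK δ D * (l ^ 2 * F * (4 * s + 1)) ≤
        ∑ k, ((star (x k) * linf B 0 x k).re + a k * (‖x k‖ ^ 2 - 1) -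
        KK δ D * (‖linf B 0 x k‖ ^ 2 + a k ^ 2))} ∪
      ⋃ k : Fin n, {x | s * ∑ j, ‖(if j < k then B k j else 0)‖ ^ 2 <
        ‖∑ j, (if j < k then B k j else 0) * x j‖ ^ 2} := by
    intro x hx
    by_contra hc
    simp only [Set.mem_union, Set.mem_iUnion, Set.mem_setOf_eq, not_or, not_exists, not_lt] at hc hx
    obtain ⟨hc1, hc2⟩ := hc
    apply hc1
    rw [Finset.sum_sub_distrib, ← hid x, ← Finset.mul_sum, Finset.sum_add_distrib]
    have h1 : ∑ k, ‖linf B 0 x k‖ ^ 2 ≤ s * (l ^ 2 * (4 * F)) := by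
      calc _ ≤ ∑ k, s * ∑ j, ‖(if j < k then B k j else 0)‖ ^ 2 :=
            Finset.sum_le_sum fun k _ => by rw [hlin]; exact hc2 k
        _ ≤ _ := by rw [← Finset.mul_sum]; gcongr
    have h2 : ∑ k, ‖linf B 0 x k‖ ^ 2 + ∑ k, a k ^ 2 ≤ l ^ 2 * F * (4 * s + 1) := by linarith
    have h3 := mul_le_mul_of_nonneg_left h2 hK.le
    have h4 := mul_le_mul_of_nonneg_left hx hl.le
    linarith
  refine (measure_mono hsub).trans ((measure_union_le _ _).trans (add_le_add ?_ ?_))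
  · refine (multi_tail hμ B 0 a ha1 _).trans (le_of_eq ?_)
    congr 2; ring
  · refine (measure_iUnion_le _).trans ?_
    rw [tsum_fintype]
    refine (Finset.sum_le_sum fun k _ => lin_tail hμ hδ hD _ hs).trans ?_
    simp

lemma quad_tail {δ D : ℝ} {n : ℕ} {μ : Fin n → Measure ℂ} (hμ : ∀ j, SubG (μ j) δ D) (hδ : 0 < δ)
    (hD : 1 ≤ D) (A : Matrix (Fin n) (Fin n) ℂ) {F l s : ℝ} (hF : ∑ j, ∑ k, ‖A j k‖ ^ 2 ≤ F)
    (hl : 0 < l) (hlF : l ^ 2 * F ≤ (δ / 4) ^ 2) (hs : 0 < s) (r : ℝ) :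
    Measure.pi μ {x | 2 * r ≤ ‖qf A x - A.trace‖} ≤
      4 * (ENNReal.ofReal (Real.exp (-(l * r) + KK δ D * (l ^ 2 * F * (4 * s + 1)))) +
        n * (4 * ENNReal.ofReal (Real.exp (-(s / (16 * KK δ D)))))) := by
  have hsub : {x : Fin n → ℂ | 2 * r ≤ ‖qf A x - A.trace‖} ⊆
      ⋃ m : Fin 4, {x | r ≤ (qf (Complex.I ^ (m:ℕ) • A) x - (Complex.I ^ (m:ℕ) • A).trace).re} := by
    intro x hx
    obtain ⟨m, hm⟩ := dir4 hx
    refine Set.mem_iUnion.mpr ⟨m, ?_⟩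
    have : qf (Complex.I ^ (m:ℕ) • A) x - (Complex.I ^ (m:ℕ) • A).trace =
        Complex.I ^ (m:ℕ) * (qf A x - A.trace) := by
      rw [Matrix.trace_smul, smul_eq_mul, mul_sub, qf, qf, Finset.mul_sum]
      congr 1
      refine Finset.sum_congr rfl fun j _ => ?_
      rw [Finset.mul_sum]
      refine Finset.sum_congr rfl fun k _ => ?_
      rw [Matrix.smul_apply, smul_eq_mul]; ring
    rw [Set.mem_setOf_eq, this]
    exact hm
  refine (measure_mono hsub).trans ((measure_iUnion_le _).trans ?_)
  rw [tsum_fintype]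
  refine (Finset.sum_le_sum (s := Finset.univ)
    (g := fun _ => ENNReal.ofReal (Real.exp (-(l * r) + KK δ D * (l ^ 2 * F * (4 * s + 1)))) +
        n * (4 * ENNReal.ofReal (Real.exp (-(s / (16 * KK δ D))))))
    fun (m : Fin 4) _ => quad_dir hμ hδ hD (Complex.I ^ (m:ℕ) • A) (F := F) ?_ hl hlF hs r).trans ?_
  · simpa using hF
  · rw [Finset.sum_const, Finset.card_univ, Fintype.card_fin, nsmul_eq_mul]
    norm_num


lemma indep_bound {Ω α β : Type*} [MeasurableSpace Ω] [MeasurableSpace α] [MeasurableSpace β]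
    {P : Measure Ω} [IsProbabilityMeasure P] {X : Ω → α} {Y : Ω → β} (hX : AEMeasurable X P)
    (hY : AEMeasurable Y P) (hi : IndepFun X Y P) {S : Set (α × β)} (hS : MeasurableSet S)
    {b : ℝ≥0∞} (hb : ∀ y, P.map X {x | (x, y) ∈ S} ≤ b) : P {ω | (X ω, Y ω) ∈ S} ≤ b := by
  have h1 : P {ω | (X ω, Y ω) ∈ S} = P.map (fun ω => (X ω, Y ω)) S :=
    (Measure.map_apply_of_aemeasurable (hX.prodMk hY) hS).symm
  have hpX := Measure.isProbabilityMeasure_map (μ := P) hX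
  have hpY := Measure.isProbabilityMeasure_map (μ := P) hY
  rw [h1, (indepFun_iff_map_prod_eq_prod_map_map hX hY).mp hi, Measure.prod_apply_symm hS]
  calc _ ≤ ∫⁻ y, b ∂(P.map Y) := lintegral_mono fun y => hb y
    _ = b := by simp

lemma measurable_rsv {n : ℕ} (z : ℂ) (j k : Fin n) :
    Measurable fun B : Fin n → Fin n → ℂ => rsv (Matrix.of B) z j k := by
  unfold rsv
  have hc : Continuous fun B : Fin n → Fin n → ℂ => (Matrix.of B - z • (1 : Matrix (Fin n) (Fin n) ℂ)) := by
    refine Continuous.sub ?_ continuous_const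
    exact continuous_id
  simp only [Matrix.inv_def, Matrix.smul_apply, Ring.inverse_eq_inv', smul_eq_mul]
  refine Measurable.mul ?_ ?_
  · exact (hc.matrix_det.measurable).inv
  · exact ((hc.matrix_adjugate).matrix_elem j k).measurable

section W
variable {Ω : Type} [MeasurableSpace Ω] {P : Measure Ω} {n : ℕ}
  {H : Ω → Matrix (Fin (n+1)) (Fin (n+1)) ℂ} {ν : Measure ℂ} {ν' : Measure ℝ}

lemma W_aem_le (W : IsWignerMatrix P (n+1) H ν ν') {i j : Fin (n+1)} (hij : i ≤ j) :
    AEMeasurable (fun ω => H ω i j) P := by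
  have hN : (0:ℝ) < Real.sqrt ((n+1 : ℕ) : ℝ) := Real.sqrt_pos.mpr (by positivity)
  have := W.probν
  have := W.probν'
  rcases hij.eq_or_lt with h | h
  · subst h
    have h1 : AEMeasurable (fun ω => Real.sqrt ((n+1 : ℕ) : ℝ) * (H ω i i).re) P := by
      apply aemeasurable_of_map_neZero
      rw [W.diag i]; infer_instance
    have h2 : (fun ω => H ω i i) = fun ω =>
        (((Real.sqrt ((n+1 : ℕ) : ℝ))⁻¹ * (Real.sqrt ((n+1 : ℕ) : ℝ) * (H ω i i).re) : ℝ) : ℂ) := by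
      funext ω
      rw [inv_mul_cancel_left₀ hN.ne']
      apply Complex.ext
      · simp
      · simp [W.diag_real]
    rw [h2]
    exact Complex.measurable_ofReal.comp_aemeasurable (h1.const_mul _)
  · have h1 : AEMeasurable (fun ω => (Real.sqrt ((n+1 : ℕ) : ℝ) : ℂ) * H ω i j) P := by
      apply aemeasurable_of_map_neZero
      rw [W.offdiag i j h]; infer_instance
    have h2 : (fun ω => H ω i j) = fun ω =>
        (Real.sqrt ((n+1 : ℕ) : ℝ) : ℂ)⁻¹ * ((Real.sqrt ((n+1 : ℕ) : ℝ) : ℂ) * H ω i j) := by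
      funext ω
      rw [inv_mul_cancel_left₀]
      exact_mod_cast hN.ne'
    rw [h2]
    exact h1.const_mul _

lemma W_star (W : IsWignerMatrix P (n+1) H ν ν') (i j : Fin (n+1)) (ω : Ω) :
    H ω i j = star (H ω j i) := ((W.herm ω).apply i j).symm

def srt (a b : Fin (n+1)) : {p : Fin (n+1) × Fin (n+1) // p.1 ≤ p.2} :=
  ⟨(min a b, max a b), min_le_max⟩

def unsrt (a b : Fin (n+1)) (w : ℂ) : ℂ := if a ≤ b then w else star w

lemma unsrt_meas (a b : Fin (n+1)) : Measurable (unsrt a b) := by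
  unfold unsrt
  split_ifs <;> fun_prop

lemma W_srt (W : IsWignerMatrix P (n+1) H ν ν') (a b : Fin (n+1)) (ω : Ω) :
    H ω a b = unsrt a b (H ω (srt a b).1.1 (srt a b).1.2) := by
  unfold srt unsrt
  split_ifs with h
  · simp [h]
  · have h' : b ≤ a := (not_le.mp h).le
    simp only [min_eq_right h', max_eq_left h']
    exact W_star W a b ω

/-- rescaled column -/
def colv (H : Ω → Matrix (Fin (n+1)) (Fin (n+1)) ℂ) (i : Fin (n+1)) (ω : Ω) (j : Fin n) : ℂ :=
  (Real.sqrt ((n+1 : ℕ) : ℝ) : ℂ) * H ω (i.succAbove j) i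

def colf (i : Fin (n+1)) (j : Fin n) (w : ℂ) : ℂ :=
  (Real.sqrt ((n+1 : ℕ) : ℝ) : ℂ) * unsrt (i.succAbove j) i w

lemma colf_meas (i : Fin (n+1)) (j : Fin n) : Measurable (colf i j) :=
  (unsrt_meas _ _).const_mul _

lemma srt_eq_iff {a b c d : Fin (n+1)} (h : srt a b = srt c d) :
    (a = c ∧ b = d) ∨ (a = d ∧ b = c) := by
  have h' := congrArg Subtype.val h
  simp only [srt, Prod.mk.injEq] at h'
  obtain ⟨h1, h2⟩ := h'
  simp only [Fin.ext_iff, Fin.coe_min, Fin.coe_max] at *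
  omega

lemma srt_inj (i : Fin (n+1)) : Function.Injective fun j : Fin n => srt (i.succAbove j) i := by
  intro j k h
  rcases srt_eq_iff h with ⟨h, _⟩ | ⟨h, h'⟩
  · exact Fin.succAbove_right_injective h
  · exact absurd h (Fin.succAbove_ne i j)

lemma W_aem_p (W : IsWignerMatrix P (n+1) H ν ν')
    (p : {p : Fin (n+1) × Fin (n+1) // p.1 ≤ p.2}) : AEMeasurable (fun ω => H ω p.1.1 p.1.2) P :=
  W_aem_le W p.2

lemma W_aem (W : IsWignerMatrix P (n+1) H ν ν') (a b : Fin (n+1)) :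
    AEMeasurable (fun ω => H ω a b) P := by
  simp_rw [W_srt W a b]
  exact (unsrt_meas a b).comp_aemeasurable (W_aem_p W _)

lemma colv_aem (W : IsWignerMatrix P (n+1) H ν ν') (i : Fin (n+1)) (j : Fin n) :
    AEMeasurable (fun ω => colv H i ω j) P := (W_aem W _ _).const_mul _

lemma colv_eq (W : IsWignerMatrix P (n+1) H ν ν') (i : Fin (n+1)) (j : Fin n) (ω : Ω) :
    colv H i ω j = colf i j (H ω (srt (i.succAbove j) i).1.1 (srt (i.succAbove j) i).1.2) := by
  rw [colv, colf, ← W_srt W]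

lemma col_pi (W : IsWignerMatrix P (n+1) H ν ν') (i : Fin (n+1)) :
    P.map (colv H i) = Measure.pi fun j => P.map (fun ω => colv H i ω j) := by
  have := W.prob
  have h1 := (W.indep.precomp (srt_inj i)).comp (fun j => colf i j) (fun j => colf_meas i j)
  have h2 : iIndepFun (fun j ω => colv H i ω j) P := by
    convert h1 using 2 with j
    funext ω
    exact colv_eq W i j ω
  exact (iIndepFun_iff_map_fun_eq_pi_map (fun j => colv_aem W i j)).mp h2

lemma col_indep (W : IsWignerMatrix P (n+1) H ν ν') (i : Fin (n+1)) :
    IndepFun (colv H i) (fun ω (j k : Fin n) => H ω (i.succAbove j) (i.succAbove k)) P := by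
  have := W.prob
  classical
  set S : Finset {p : Fin (n+1) × Fin (n+1) // p.1 ≤ p.2} :=
    Finset.univ.image fun j : Fin n => srt (i.succAbove j) i with hS
  set T : Finset {p : Fin (n+1) × Fin (n+1) // p.1 ≤ p.2} :=
    Finset.univ.image fun q : Fin n × Fin n => srt (i.succAbove q.1) (i.succAbove q.2) with hT
  have hST : Disjoint S T := by
    rw [Finset.disjoint_left]
    intro p hp hp'
    simp only [hS, hT, Finset.mem_image, Finset.mem_univ, true_and] at hp hp'
    obtain ⟨j, rfl⟩ := hp
    obtain ⟨q, hq⟩ := hp'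
    rcases srt_eq_iff hq with ⟨_, h⟩ | ⟨h, _⟩
    · exact Fin.succAbove_ne i _ h
    · exact Fin.succAbove_ne i _ h
  have h1 := W.indep.indepFun_finset₀ S T hST (W_aem_p W)
  have h2 := h1.comp
    (φ := fun (y : S → ℂ) (j : Fin n) => colf i j (y ⟨srt (i.succAbove j) i, by simp [hS]⟩))
    (ψ := fun (y : T → ℂ) (j k : Fin n) => unsrt (i.succAbove j) (i.succAbove k)
      (y ⟨srt (i.succAbove j) (i.succAbove k), by
        simp only [hT, Finset.mem_image, Finset.mem_univ, true_and]; exact ⟨(j, k), rfl⟩⟩))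
    (measurable_pi_lambda _ fun j => (colf_meas i j).comp (measurable_pi_apply _))
    (measurable_pi_lambda _ fun j => measurable_pi_lambda _ fun k =>
      (unsrt_meas _ _).comp (measurable_pi_apply _))
  convert h2 using 1
  · funext ω j
    exact colv_eq W i j ω
  · funext ω j k
    exact W_srt W _ _ ω

lemma SubG.conj {μ : Measure ℂ} {δ D : ℝ} (h : SubG μ δ D) : SubG (μ.map star) δ D := by
  have hm : Measurable (star : ℂ → ℂ) := by fun_prop
  have := h.prob
  refine ⟨Measure.isProbabilityMeasure_map hm.aemeasurable, h.pos, ?_, ?_, ?_⟩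
  · rw [integral_map hm.aemeasurable (by fun_prop)]
    have : ∫ z, star z ∂μ = star (∫ z, z ∂μ) := integral_conj
    rw [this, h.mean, star_zero]
  · rw [integral_map hm.aemeasurable (by fun_prop)]
    simpa using h.var
  · rw [lintegral_map (by fun_prop) hm]
    simpa using h.mom

lemma W_subG {δ₀ D D' : ℝ} (W : IsWignerMatrix P (n+1) H ν ν') (hC : CondC1 ν ν' δ₀ D D') :
    SubG ν δ₀ D := ⟨W.probν, hC.1, W.mean, W.var, hC.2.1⟩

lemma col_subG {δ₀ D D' : ℝ} (W : IsWignerMatrix P (n+1) H ν ν') (hC : CondC1 ν ν' δ₀ D D')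
    (i : Fin (n+1)) (j : Fin n) : SubG (P.map (fun ω => colv H i ω j)) δ₀ D := by
  have h0 := W_subG W hC
  rcases lt_or_gt_of_ne (Fin.succAbove_ne i j) with h | h
  · have := W.offdiag _ _ h
    unfold colv
    rw [this]; exact h0
  · have h1 := W.offdiag _ _ h
    have h2 : (fun ω => colv H i ω j) = fun ω => star
        ((Real.sqrt ((n+1 : ℕ) : ℝ) : ℂ) * H ω i (i.succAbove j)) := by
      funext ω
      rw [colv, W_star W (i.succAbove j) i ω]
      simp
    rw [h2]
    have h3 := AEMeasurable.map_map_of_aemeasurable (μ := P) (g := (star : ℂ → ℂ))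
      (f := fun ω => (Real.sqrt ((n+1 : ℕ) : ℝ) : ℂ) * H ω i (i.succAbove j))
      (by fun_prop) ((W_aem W _ _).const_mul _)
    rw [h1] at h3
    have h4 := h0.conj
    rw [h3] at h4
    exact h4

lemma col_fail {δ₀ D D' : ℝ} (W : IsWignerMatrix P (n+1) H ν ν') (hC : CondC1 ν ν' δ₀ D D')
    (i : Fin (n+1)) (z : ℂ) {F l s : ℝ} 
    (hl : 0 < l) (hlF : l ^ 2 * F ≤ (δ₀ / 4) ^ 2) (hs : 0 < s) (r : ℝ) :
    P {ω | ∑ j, ∑ k, ‖rsv (minorM (H ω) i) z j k‖ ^ 2 ≤ ((n:ℝ)+1) ^ 2 * F ∧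
      2 * r < ‖qdev (H ω) z i‖} ≤
      4 * (ENNReal.ofReal (Real.exp (-(l * r) + KK δ₀ D * (l ^ 2 * F * (4 * s + 1)))) +
        n * (4 * ENNReal.ofReal (Real.exp (-(s / (16 * KK δ₀ D)))))) := by
  have := W.prob
  set S : Set ((Fin n → ℂ) × (Fin n → Fin n → ℂ)) := {p |
    ∑ j, ∑ k, ‖rsv (Matrix.of p.2) z j k‖ ^ 2 ≤ ((n:ℝ)+1) ^ 2 * F ∧
      2 * r < ‖(∑ j, ∑ k, star (p.1 j) * (rsv (Matrix.of p.2) z j k / (n+1)) * p.1 k) -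
        ∑ j, rsv (Matrix.of p.2) z j j / (n+1)‖} with hS
  have hR : ∀ j k, Measurable fun p : (Fin n → ℂ) × (Fin n → Fin n → ℂ) =>
      rsv (Matrix.of p.2) z j k := fun j k => (measurable_rsv z j k).comp measurable_snd
  have hx : ∀ j, Measurable fun p : (Fin n → ℂ) × (Fin n → Fin n → ℂ) => p.1 j :=
    fun j => (measurable_pi_apply j).comp measurable_fst
  have hSm : MeasurableSet S := by
    refine MeasurableSet.inter ?_ ?_
    · refine measurableSet_le (Finset.measurable_fun_sum _ fun j _ => Finset.measurable_fun_sum _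
        fun k _ => (hR j k).norm.pow_const 2) measurable_const
    · refine measurableSet_lt measurable_const (Measurable.norm (Measurable.sub ?_ ?_))
      · refine Finset.measurable_fun_sum _ fun j _ => Finset.measurable_fun_sum _ fun k _ => ?_
        exact ((Complex.continuous_conj.measurable.comp (hx j)).mul ((hR j k).div_const _)).mul (hx k)
      · exact Finset.measurable_fun_sum _ fun j _ => (hR j j).div_const _
  have hXm : AEMeasurable (colv H i) P := aemeasurable_pi_lambda _ fun j => colv_aem W i j
  have hYm : AEMeasurable (fun ω (j k : Fin n) => H ω (i.succAbove j) (i.succAbove k)) P :=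
    aemeasurable_pi_lambda _ fun j => aemeasurable_pi_lambda _ fun k => W_aem W _ _
  refine le_trans (measure_mono ?_) (indep_bound hXm hYm (col_indep W i) hSm ?_)
  · intro ω hω
    obtain ⟨h1, h2⟩ := hω
    refine ⟨h1, ?_⟩
    convert h2 using 2
    rw [qdev, qf, Matrix.trace, Finset.sum_div]
    congr 1
    refine Finset.sum_congr rfl fun j _ => Finset.sum_congr rfl fun k _ => ?_
    change star (colv H i ω j) * (rsv (minorM (H ω) i) z j k / (n+1)) * colv H i ω k = _
    have hN : (Real.sqrt ((n+1 : ℕ) : ℝ) : ℂ) * (Real.sqrt ((n+1 : ℕ) : ℝ) : ℂ) = n + 1 := by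
      rw [← Complex.ofReal_mul, Real.mul_self_sqrt (by positivity)]; push_cast; rfl
    have hn : (n + 1 : ℂ) ≠ 0 := by exact_mod_cast Nat.succ_ne_zero n
    rw [colv, colv, star_mul', Complex.star_def, Complex.conj_ofReal]
    field_simp
    rw [pow_two, hN]
    ring
  · intro B
    rw [col_pi W i]
    by_cases hB : ∑ j, ∑ k, ‖rsv (Matrix.of B) z j k‖ ^ 2 ≤ ((n:ℝ)+1) ^ 2 * F
    · have hA : ∑ j, ∑ k, ‖(fun j k => rsv (Matrix.of B) z j k / (n+1) : Matrix (Fin n) (Fin n) ℂ) j k‖ ^ 2 ≤ F := by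
        have hn : ‖(n + 1 : ℂ)‖ = n + 1 := by
          have : ((n + 1 : ℕ) : ℂ) = n + 1 := by push_cast; rfl
          rw [← this, Complex.norm_natCast]; push_cast; rfl
        simp only [norm_div, div_pow, ← Finset.sum_div, hn]
        rw [div_le_iff₀ (by positivity)]
        linarith
      refine le_trans (measure_mono ?_) (quad_tail (fun j => col_subG W hC i j) hC.1
        (W_subG W hC).one_le _ hA hl hlF hs r)
      intro x hx
      exact hx.2.le
    · have : {x | (x, B) ∈ S} = ∅ := by
        ext x
        simp only [hS, Set.mem_setOf_eq, Set.mem_empty_iff_false, iff_false]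
        exact fun h => hB h.1
      rw [this]; simp

lemma diag_fail {δ₀ D D' : ℝ} (W : IsWignerMatrix P (n+1) H ν ν') (hC : CondC1 ν ν' δ₀ D D')
    (i : Fin (n+1)) {ε : ℝ} (hε : 0 ≤ ε) :
    P {ω | ε < ‖H ω i i‖} ≤ ENNReal.ofReal (D' * Real.exp (-(δ₀ * ε ^ 2 * (n+1)))) := by
  have hδ := hC.1
  have h1 : AEMeasurable (fun ω => Real.sqrt ((n+1 : ℕ) : ℝ) * (H ω i i).re) P :=
    (Complex.measurable_re.comp_aemeasurable (W_aem W i i)).const_mul _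
  have h2 : {ω | ε < ‖H ω i i‖} ⊆ (fun ω => Real.sqrt ((n+1 : ℕ) : ℝ) * (H ω i i).re) ⁻¹'
      {x | ENNReal.ofReal (Real.exp (δ₀ * ε ^ 2 * (n+1))) ≤ ENNReal.ofReal (Real.exp (δ₀ * x ^ 2))} := by
    intro ω hω
    have hω' : ε < ‖H ω i i‖ := hω
    have h3 : ‖H ω i i‖ ^ 2 = (H ω i i).re ^ 2 := by
      rw [← Complex.normSq_eq_norm_sq, Complex.normSq_apply, W.diag_real]; ring
    refine ENNReal.ofReal_le_ofReal (Real.exp_le_exp.mpr ?_)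
    rw [mul_pow, Real.sq_sqrt (by positivity), ← h3]
    push_cast
    have : ε ^ 2 ≤ ‖H ω i i‖ ^ 2 := by gcongr
    have h4 := mul_le_mul_of_nonneg_left this (by positivity : 0 ≤ δ₀ * ((n:ℝ)+1))
    linarith
  refine (measure_mono h2).trans ?_
  have hS : MeasurableSet {x : ℝ | ENNReal.ofReal (Real.exp (δ₀ * ε ^ 2 * (n+1))) ≤
      ENNReal.ofReal (Real.exp (δ₀ * x ^ 2))} :=
    measurableSet_le measurable_const (by fun_prop)
  rw [← Measure.map_apply_of_aemeasurable h1 hS, W.diag i]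
  have h5 := mul_meas_ge_le_lintegral₀ (μ := ν') (f := fun x => ENNReal.ofReal (Real.exp (δ₀ * x ^ 2)))
    (by fun_prop) (ENNReal.ofReal (Real.exp (δ₀ * ε ^ 2 * (n+1))))
  have h6 := h5.trans hC.2.2
  rw [Real.exp_neg, ENNReal.ofReal_mul' (by positivity), ENNReal.ofReal_inv_of_pos (Real.exp_pos _),
    ← div_eq_mul_inv, ENNReal.le_div_iff_mul_le (by left; simp [Real.exp_pos]) (by left; simp),
    mul_comm]
  exact h6
end W


lemma grid {N : ℕ} (hN : 0 < N) {μ b : ℝ} (hμ : |μ| ≤ b) (hb : b ≤ 2) :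
    ∃ l ∈ Finset.Icc (-(2 * N : ℤ)) (2 * N), |(l:ℝ) / N| ≤ b ∧ |μ - l / N| ≤ 1 / N := by
  have hN' : (0:ℝ) < N := by exact_mod_cast hN
  have key : ∀ x : ℝ, 0 ≤ x → x ≤ b → ∃ l : ℤ, 0 ≤ l ∧ l ≤ 2 * N ∧ (l:ℝ) / N ≤ b ∧
      |x - l / N| ≤ 1 / N := by
    intro x hx hxb
    have h1 := Int.floor_le (N * x)
    have h2 := (Int.lt_floor_add_one (N * x)).le
    have h3 : ((⌊N * x⌋ : ℤ) : ℝ) / N ≤ x := by rw [div_le_iff₀ hN']; linarith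
    have h4 : x ≤ ((⌊N * x⌋ : ℤ) : ℝ) / N + 1 / N := by
      rw [← add_div, le_div_iff₀ hN']; linarith
    refine ⟨⌊N * x⌋, by positivity, ?_, h3.trans hxb, ?_⟩
    · have : ((⌊N * x⌋ : ℤ) : ℝ) ≤ 2 * N := by nlinarith
      exact_mod_cast this
    · rw [abs_le]; constructor <;> [(have : 0 ≤ 1 / (N:ℝ) := by positivity); skip] <;> linarith
  rcases le_total 0 μ with h | h
  · rw [abs_of_nonneg h] at hμ
    obtain ⟨l, h0, h1, h2, h3⟩ := key μ h hμ
    refine ⟨l, Finset.mem_Icc.mpr ⟨by omega, h1⟩, ?_, h3⟩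
    rw [abs_of_nonneg (by have : (0:ℝ) ≤ l := by exact_mod_cast h0
                          positivity)]
    exact h2
  · rw [abs_of_nonpos h] at hμ
    obtain ⟨l, h0, h1, h2, h3⟩ := key (-μ) (by linarith) hμ
    refine ⟨-l, Finset.mem_Icc.mpr ⟨by omega, by omega⟩, ?_, ?_⟩
    · push_cast
      rw [neg_div, abs_neg, abs_of_nonneg (by have : (0:ℝ) ≤ l := by exact_mod_cast h0
                                              positivity)]
      exact h2
    · push_cast
      rw [← abs_neg]
      convert h3 using 2
      ring

lemma det_main {n : ℕ} {A : Matrix (Fin (n+1)) (Fin (n+1)) ℂ} (hA : A.IsHermitian)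
    {κ M c2 ε : ℝ} (hκ : 0 < κ) (hκ2 : κ ≤ 2) (hc2 : c2 = κ / 2 / 64) (hε : ε = (κ / 2) ^ 2 / 96)
    (hM1 : 1 ≤ c2 * M ^ 2) (hM2 : 1 / (c2 * M ^ 2) ≤ ε)
    (K : ℕ) (hK1 : (1/2 : ℝ) ^ (K+1) < c2 * M ^ 2 / (n+1))
    (hK2 : c2 * M ^ 2 / (n+1) ≤ (1/2 : ℝ) ^ K)
    (hd : ∀ i, ‖A i i‖ ≤ ε)
    (hQ : ∀ l ∈ Finset.Icc (-(2 * (n+1 : ℕ) : ℤ)) (2 * (n+1 : ℕ)), ∀ k ≤ K, ∀ i,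
      ∑ j, ∑ m, ‖rsv (minorM A i) (((l / (n+1) : ℝ) : ℂ) + ((1/2 : ℝ) ^ k : ℝ) * Complex.I) j m‖ ^ 2
        ≤ ((n:ℝ)+1) ^ 2 * ((2 * (8 / (κ/2)) + 1) / ((n+1) * (1/2 : ℝ) ^ K)) →
      ‖qdev A (((l / (n+1) : ℝ) : ℂ) + ((1/2 : ℝ) ^ k : ℝ) * Complex.I) i‖ ≤ ε)
    {μ : ℝ} (hμ : μ ∈ Set.Icc (-2 + κ) (2 - κ)) {v : Fin (n+1) → ℂ} (hv : ∑ i, ‖v i‖ ^ 2 = 1)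
    (he : A.mulVec v = (μ : ℂ) • v) (i : Fin (n+1)) : ‖v i‖ ^ 2 < M ^ 2 / (n+1) := by
  have hN : (0:ℝ) < n + 1 := by positivity
  obtain ⟨l, hl, hE, hEμ⟩ := grid (N := n+1) (Nat.succ_pos n) (μ := μ) (b := 2 - κ)
    (abs_le.mpr ⟨by linarith [hμ.1], hμ.2⟩) (by linarith)
  push_cast at hE hEμ
  set E : ℝ := l / (n+1) with hEdef
  set η : ℝ := (1/2 : ℝ) ^ K with hη
  have hη0 : 0 < η := by positivity
  have h1 : 1 / ((n:ℝ)+1) ≤ η := le_trans (by gcongr) hK2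
  have hb := boot hA (E := E) (c := κ/2) (ε := ε) (by positivity)
    (by nlinarith [abs_le.mp hE, sq_abs E, abs_nonneg E]) hε (η := fun k => (1/2 : ℝ) ^ k)
    (fun k => rfl) K (by
      refine le_trans ?_ hM2
      have : c2 * M ^ 2 ≤ (n+1) * η := by
        rw [div_le_iff₀ hN] at hK2; linarith
      change 1 / ((n+1) * η) ≤ _
      gcongr) hd (fun k hk i => hQ l hl k hk i) K le_rfl i
  have hz : ((E : ℂ) + (η : ℂ) * Complex.I).im = η := by simp
  have h2 := eigvec_bound hA (z := (E : ℂ) + (η : ℂ) * Complex.I) (by rw [hz]; exact hη0) he hv i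
  rw [hz] at h2
  have h3 : ‖(μ:ℂ) - ((E : ℂ) + (η : ℂ) * Complex.I)‖ ^ 2 = (μ - E) ^ 2 + η ^ 2 := by
    rw [← Complex.normSq_eq_norm_sq, Complex.normSq_apply]
    simp; ring
  have h4 : (μ - E) ^ 2 ≤ η ^ 2 := by
    rw [← sq_abs (μ - E)]
    exact pow_le_pow_left₀ (abs_nonneg _) (hEμ.trans h1) 2
  rw [h3] at h2
  have h5 : ‖v i‖ ^ 2 * η ≤ (2 * η ^ 2) * (8 / (κ/2)) := by
    refine h2.trans (mul_le_mul (by linarith) hb (norm_nonneg _) (by positivity))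
  have h6 : ‖v i‖ ^ 2 ≤ 2 * η * (8 / (κ/2)) := by
    have : ‖v i‖ ^ 2 * η ≤ (2 * η * (8 / (κ/2))) * η := by linarith
    exact le_of_mul_le_mul_right this hη0
  have h7 : η < 2 * (c2 * M ^ 2 / (n+1)) := by
    rw [pow_succ] at hK1; linarith
  have h8 : 2 * η * (8 / (κ/2)) < M ^ 2 / (n+1) := by
    calc 2 * η * (8 / (κ/2)) < 2 * (2 * (c2 * M ^ 2 / (n+1))) * (8 / (κ/2)) := by gcongr
      _ = M ^ 2 / (n+1) / 2 := by rw [hc2]; field_simp; ring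
      _ ≤ _ := by have : 0 ≤ M ^ 2 / ((n:ℝ)+1) := by positivity
                  linarith
  linarith


lemma union_fin {Ω ι : Type*} [MeasurableSpace Ω] [Fintype ι] (P : Measure Ω) (S : ι → Set Ω)
    {b : ℝ} {m : ℕ} (hm : Fintype.card ι ≤ m) (h : ∀ i, P (S i) ≤ ENNReal.ofReal b) :
    P (⋃ i, S i) ≤ ENNReal.ofReal (m * b) := by
  refine (measure_iUnion_le _).trans ?_
  rw [tsum_fintype]
  refine (Finset.sum_le_sum fun i _ => h i).trans ?_
  rw [Finset.sum_const, Finset.card_univ, nsmul_eq_mul, ENNReal.ofReal_mul (by positivity),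
    ENNReal.ofReal_natCast]
  gcongr

lemma col_fail' {Ω : Type} [MeasurableSpace Ω] {P : Measure Ω} {n : ℕ}
    {H : Ω → Matrix (Fin (n+1)) (Fin (n+1)) ℂ} {ν : Measure ℂ} {ν' : Measure ℝ}
    {δ₀ D D' : ℝ} (W : IsWignerMatrix P (n+1) H ν ν') (hC : CondC1 ν ν' δ₀ D D')
    (i : Fin (n+1)) (z : ℂ) {F M C3 ε c5 : ℝ} (hM : 1 ≤ M) (hF0 : 0 ≤ F) (hF : F * M ^ 2 ≤ C3)
    (hM3 : C3 / M ≤ (δ₀ / 4) ^ 2) (hc5 : c5 ≤ ε / 2) (hc5' : c5 ≤ 1 / (16 * KK δ₀ D)) :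
    P {ω | ∑ j, ∑ k, ‖rsv (minorM (H ω) i) z j k‖ ^ 2 ≤ ((n:ℝ)+1) ^ 2 * F ∧
      ε < ‖qdev (H ω) z i‖} ≤
      ENNReal.ofReal (16 * (n+1) * Real.exp (5 * KK δ₀ D * C3) * Real.exp (-(c5 * Real.sqrt M))) := by
  have hK := KK_pos hC.1 (W_subG W hC).one_le
  have hM0 : 0 < M := by linarith
  set t := Real.sqrt M with ht
  have ht2 : t ^ 2 = M := Real.sq_sqrt hM0.le
  have ht1 : 1 ≤ t := by rw [ht]; exact Real.one_le_sqrt.mpr hM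
  have hFM : M * F ≤ C3 / M := by rw [le_div_iff₀ hM0]; linarith
  have hC3 : 0 ≤ C3 := le_trans (by positivity) hF
  have h := col_fail W hC i z (F := F) (l := t) (s := t) (by linarith)
    (by rw [ht2]; exact hFM.trans hM3) (by linarith) (ε / 2)
  rw [mul_div_cancel₀ ε (two_ne_zero)] at h
  refine h.trans ?_
  have e1 : Real.exp (-(t * (ε / 2)) + KK δ₀ D * (t ^ 2 * F * (4 * t + 1))) ≤
      Real.exp (5 * KK δ₀ D * C3) * Real.exp (-(c5 * t)) := by
    rw [← Real.exp_add, Real.exp_le_exp]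
    have h1 : t ^ 2 * F * (4 * t + 1) ≤ 5 * C3 := by
      have h2 : t ^ 2 * F * t ≤ C3 := by
        have : t ^ 2 * F * t ≤ t ^ 4 * F := by
          have : 0 ≤ t ^ 2 * F := by positivity
          nlinarith [mul_nonneg this (by nlinarith : 0 ≤ t ^ 2 - t)]
        have h4 : t ^ 4 * F = F * M ^ 2 := by rw [← ht2]; ring
        linarith
      have h3 : t ^ 2 * F ≤ t ^ 2 * F * t := le_mul_of_one_le_right (by positivity) ht1
      linarith
    have h5 := mul_le_mul_of_nonneg_left h1 hK.le
    have h6 := mul_le_mul_of_nonneg_left hc5 (by linarith : 0 ≤ t)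
    linarith
  have e2 : Real.exp (-(t / (16 * KK δ₀ D))) ≤
      Real.exp (5 * KK δ₀ D * C3) * Real.exp (-(c5 * t)) := by
    rw [← Real.exp_add, Real.exp_le_exp]
    have h6 := mul_le_mul_of_nonneg_left hc5' (by linarith : 0 ≤ t)
    have h7 : t * (1 / (16 * KK δ₀ D)) = t / (16 * KK δ₀ D) := by ring
    have : 0 ≤ 5 * KK δ₀ D * C3 := by positivity
    linarith
  set X := Real.exp (5 * KK δ₀ D * C3) * Real.exp (-(c5 * t)) with hX
  have hX0 : 0 ≤ X := by positivity
  clear_value X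
  calc _ ≤ 4 * (ENNReal.ofReal X + n * (4 * ENNReal.ofReal X)) := by gcongr
    _ = ENNReal.ofReal (4 * (X + n * (4 * X))) := by
        rw [ENNReal.ofReal_mul (by positivity), ENNReal.ofReal_add (by positivity) (by positivity),
          ENNReal.ofReal_mul (by positivity), ENNReal.ofReal_mul (by positivity),
          ENNReal.ofReal_natCast]
        norm_num
    _ ≤ _ := by
        refine ENNReal.ofReal_le_ofReal ?_
        rw [mul_assoc (16 * ((n:ℝ)+1)), ← hX]
        linarith

lemma prob_main {Ω : Type} [MeasurableSpace Ω] {P : Measure Ω} {n : ℕ}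
    {H : Ω → Matrix (Fin (n+1)) (Fin (n+1)) ℂ} {ν : Measure ℂ} {ν' : Measure ℝ}
    {δ₀ D D' : ℝ} (W : IsWignerMatrix P (n+1) H ν ν') (hC : CondC1 ν ν' δ₀ D D')
    {κ M c2 ε C3 c5 : ℝ} (hκ : 0 < κ) (hκ2 : κ ≤ 2) (hc2 : c2 = κ / 2 / 64)
    (hε : ε = (κ / 2) ^ 2 / 96) (hC3 : C3 = (2 * (8 / (κ/2)) + 1) / c2)
    (hM : 1 ≤ M) (hM1 : 1 ≤ c2 * M ^ 2) (hM2 : 1 / (c2 * M ^ 2) ≤ ε)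
    (hM3 : C3 / M ≤ (δ₀ / 4) ^ 2) (hc5 : c5 ≤ ε / 2) (hc5' : c5 ≤ 1 / (16 * KK δ₀ D))
    (hc5'' : c5 ≤ δ₀ * ε ^ 2) (hMN : M ^ 2 ≤ n + 1) :
    P {ω | ∃ μ ∈ Set.Icc (-2 + κ) (2 - κ), ∃ v : Fin (n+1) → ℂ,
            (∑ i, ‖v i‖ ^ 2) = 1 ∧
            (H ω).mulVec v = (μ : ℂ) • v ∧
            ∃ i, M / Real.sqrt ((n+1 : ℕ) : ℝ) ≤ ‖v i‖} ≤
      ENNReal.ofReal ((|D'| + 80 * Real.exp (5 * KK δ₀ D * C3)) *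
        (((n:ℝ)+1) ^ 4 * Real.exp (-(c5 * Real.sqrt M)))) := by
  have hN : (0:ℝ) < n + 1 := by positivity
  have hc20 : 0 < c2 := by rw [hc2]; positivity
  have hc21 : c2 ≤ 1 := by rw [hc2]; linarith
  have hM0 : 0 < M := by linarith
  have hε0 : 0 ≤ ε := by rw [hε]; positivity
  have hδ := hC.1
  obtain ⟨K, hK1, hK2⟩ := exists_nat_pow_near_of_lt_one (x := c2 * M ^ 2 / (n+1)) (y := (1/2 : ℝ))
    (by positivity) (by rw [div_le_one hN]; nlinarith [sq_nonneg M]) (by norm_num) (by norm_num)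
  have hKn : K + 1 ≤ n + 1 := by
    have h1 : (2:ℝ) ^ K ≤ n + 1 := by
      have h2 : 1 / ((n:ℝ)+1) ≤ (1/2 : ℝ) ^ K := le_trans (by gcongr) hK2
      rw [one_div_pow] at h2
      exact (one_div_le_one_div hN (by positivity)).mp h2
    have h3 : 2 ^ K ≤ n + 1 := by exact_mod_cast h1
    have := Nat.lt_two_pow_self (n := K)
    omega
  set F := (2 * (8 / (κ/2)) + 1) / ((n+1) * (1/2 : ℝ) ^ K) with hF
  have hF0 : 0 ≤ F := by positivity
  have hFM : F * M ^ 2 ≤ C3 := by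
    have : c2 * M ^ 2 ≤ (n+1) * (1/2 : ℝ) ^ K := by
      rw [div_le_iff₀ hN] at hK2; linarith
    calc F * M ^ 2 ≤ (2 * (8 / (κ/2)) + 1) / (c2 * M ^ 2) * M ^ 2 := by rw [hF]; gcongr
      _ = C3 := by rw [hC3]; field_simp
  set G : Finset ℤ := Finset.Icc (-(2 * (n+1 : ℕ) : ℤ)) (2 * (n+1 : ℕ)) with hG
  set Z : G × Fin (K+1) → ℂ := fun q => (((q.1.1 / (n+1) : ℝ) : ℂ) +
    ((1/2 : ℝ) ^ (q.2 : ℕ) : ℝ) * Complex.I) with hZ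
  have hsub : {ω | ∃ μ ∈ Set.Icc (-2 + κ) (2 - κ), ∃ v : Fin (n+1) → ℂ,
            (∑ i, ‖v i‖ ^ 2) = 1 ∧
            (H ω).mulVec v = (μ : ℂ) • v ∧
            ∃ i, M / Real.sqrt ((n+1 : ℕ) : ℝ) ≤ ‖v i‖} ⊆
      (⋃ i : Fin (n+1), {ω | ε < ‖H ω i i‖}) ∪
      ⋃ q : (G × Fin (K+1)) × Fin (n+1),
        {ω | ∑ j, ∑ k, ‖rsv (minorM (H ω) q.2) (Z q.1) j k‖ ^ 2 ≤ ((n:ℝ)+1) ^ 2 * F ∧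
          ε < ‖qdev (H ω) (Z q.1) q.2‖} := by
    rintro ω ⟨μ, hμ, v, hv, he, i, hi⟩
    by_contra hc
    simp only [Set.mem_union, Set.mem_iUnion, Set.mem_setOf_eq, not_or, not_exists, not_lt,
      not_and] at hc
    obtain ⟨hd, hq⟩ := hc
    have := det_main (W.herm ω) hκ hκ2 hc2 hε hM1 hM2 K hK1 hK2 hd
      (fun l hl k hk i => hq ((⟨l, hl⟩, ⟨k, Nat.lt_succ_of_le hk⟩), i)) hμ hv he i
    have h2 : (M / Real.sqrt ((n+1 : ℕ) : ℝ)) ^ 2 ≤ ‖v i‖ ^ 2 := by gcongr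
    rw [div_pow, Real.sq_sqrt (by positivity)] at h2
    push_cast at h2
    linarith
  have hcard : Fintype.card ((G × Fin (K+1)) × Fin (n+1)) ≤ (5 * (n+1)) * (n+1) * (n+1) := by
    simp only [Fintype.card_prod, Fintype.card_fin, Fintype.card_coe]
    gcongr
    rw [hG, Int.card_Icc]
    omega
  refine (measure_mono hsub).trans ((measure_union_le _ _).trans ?_)
  have u1 := union_fin P (fun i : Fin (n+1) => {ω | ε < ‖H ω i i‖}) (m := n+1) (by simp)
    (fun i => diag_fail W hC i hε0)
  have u2 := union_fin P _ hcard (fun q : (G × Fin (K+1)) × Fin (n+1) =>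
    col_fail' W hC q.2 (Z q.1) hM hF0 hFM hM3 hc5 hc5')
  set X := Real.exp (-(c5 * Real.sqrt M)) with hX
  have v1 : ((n+1 : ℕ) : ℝ) * (D' * Real.exp (-(δ₀ * ε ^ 2 * (n+1)))) ≤ |D'| * (((n:ℝ)+1) ^ 4 * X) := by
    have hsq : Real.sqrt M ≤ n + 1 := by
      have : Real.sqrt M ≤ M := by
        rw [Real.sqrt_le_left hM0.le]; nlinarith
      nlinarith
    have h1 : Real.exp (-(δ₀ * ε ^ 2 * (n+1))) ≤ X := by
      rw [hX, Real.exp_le_exp]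
      have := mul_le_mul hc5'' hsq (Real.sqrt_nonneg _) (by positivity)
      linarith
    have h2 : ((n+1 : ℕ) : ℝ) ≤ ((n:ℝ)+1) ^ 4 := by
      push_cast
      exact le_self_pow₀ (by linarith [(Nat.cast_nonneg n : (0:ℝ) ≤ n)]) (by norm_num)
    calc _ ≤ ((n+1 : ℕ) : ℝ) * (|D'| * Real.exp (-(δ₀ * ε ^ 2 * (n+1)))) := by
          gcongr; exact le_abs_self _
      _ ≤ ((n:ℝ)+1) ^ 4 * (|D'| * X) := by gcongr
      _ = _ := by ring
  have hX0 : 0 ≤ X := (Real.exp_pos _).le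
  refine (add_le_add (u1.trans (ENNReal.ofReal_le_ofReal v1)) u2).trans ?_
  rw [← ENNReal.ofReal_add (by positivity) (by positivity)]
  apply ENNReal.ofReal_le_ofReal
  apply le_of_eq
  push_cast
  ring

/-- **Complete delocalization of eigenvectors (`ℓ^∞`-bound), optimal form.** -/
theorem stmt_4 :
    ∀ κ δ₀ D D' : ℝ, 0 < κ →
    ∃ C c : ℝ, 0 < C ∧ 0 < c ∧
    ∀ (N : ℕ) (Ω : Type) (_ : MeasurableSpace Ω) (P : Measure Ω)
      (H : Ω → Matrix (Fin N) (Fin N) ℂ) (ν : Measure ℂ) (ν' : Measure ℝ),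
      2 ≤ N →
      IsWignerMatrix P N H ν ν' →
      CondC1 ν ν' δ₀ D D' →
      ∀ M : ℝ, (Real.log N) ^ 4 ≤ M →
        P {ω | ∃ μ ∈ Set.Icc (-2 + κ) (2 - κ), ∃ v : Fin N → ℂ,
            (∑ i, ‖v i‖ ^ 2) = 1 ∧
            (H ω).mulVec v = (μ : ℂ) • v ∧
            ∃ i, M / Real.sqrt N ≤ ‖v i‖}
          ≤ ENNReal.ofReal (C * Real.exp (-(c * Real.sqrt M))) := by
  intro κ δ₀ D D' hκ
  by_cases hpar : 0 < δ₀ ∧ 1 ≤ D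
  swap
  · refine ⟨1, 1, one_pos, one_pos, ?_⟩
    intro N Ω _ P H ν ν' hN W hC
    obtain ⟨n, rfl⟩ : ∃ n, N = n + 1 := ⟨N - 1, by omega⟩
    exact absurd ⟨hC.1, (W_subG W hC).one_le⟩ hpar
  obtain ⟨hδ, hD⟩ := hpar
  have hK := KK_pos hδ hD
  obtain ⟨c2, hc2⟩ : ∃ c2, c2 = κ / 2 / 64 := ⟨_, rfl⟩
  obtain ⟨ε, hε⟩ : ∃ ε, ε = (κ / 2) ^ 2 / 96 := ⟨_, rfl⟩
  obtain ⟨C3, hC3⟩ : ∃ C3, C3 = (2 * (8 / (κ/2)) + 1) / c2 := ⟨_, rfl⟩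
  obtain ⟨c5, hc5⟩ : ∃ c5, c5 = min (min (ε / 2) (1 / (16 * KK δ₀ D))) (δ₀ * ε ^ 2) := ⟨_, rfl⟩
  have hc20 : 0 < c2 := by rw [hc2]; positivity
  have hε0 : 0 < ε := by rw [hε]; positivity
  have hC30 : 0 < C3 := by rw [hC3]; positivity
  have hc50 : 0 < c5 := by rw [hc5]; positivity
  obtain ⟨M0, hM0⟩ : ∃ M0, M0 = 1 + 1 / c2 + 1 / (c2 * ε) + C3 / (δ₀ / 4) ^ 2 := ⟨_, rfl⟩
  obtain ⟨Q, hQ⟩ : ∃ Q, Q = |D'| + 80 * Real.exp (5 * KK δ₀ D * C3) := ⟨_, rfl⟩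
  have hQ0 : 0 < Q := by rw [hQ]; positivity
  refine ⟨Q * Real.exp (8 / c5) + Real.exp (c5 / 2 * Real.sqrt M0), c5 / 2, by positivity,
    by positivity, ?_⟩
  intro N Ω _ P H ν ν' hN W hC M hM
  have := W.prob
  by_cases hMM : M < M0
  · refine prob_le_one.trans ?_
    rw [ENNReal.one_le_ofReal]
    calc (1:ℝ) ≤ Real.exp (c5 / 2 * Real.sqrt M0 + -(c5 / 2 * Real.sqrt M)) := by
          apply Real.one_le_exp
          have : Real.sqrt M ≤ Real.sqrt M0 := Real.sqrt_le_sqrt hMM.le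
          have := mul_le_mul_of_nonneg_left this (by positivity : 0 ≤ c5 / 2)
          linarith
      _ = Real.exp (c5 / 2 * Real.sqrt M0) * Real.exp (-(c5 / 2 * Real.sqrt M)) := Real.exp_add _ _
      _ ≤ _ := by
          gcongr
          have : 0 < Q * Real.exp (8 / c5) := by positivity
          linarith
  push Not at hMM
  have p1 : 0 < 1 / c2 := by positivity
  have p2 : 0 < 1 / (c2 * ε) := by positivity
  have p3 : 0 < C3 / (δ₀ / 4) ^ 2 := by positivity
  have hM1 : 1 ≤ M := by linarith
  have hMp : 0 < M := by linarith
  have hMsq : M ≤ M ^ 2 := by nlinarith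
  obtain ⟨n, rfl⟩ : ∃ n, N = n + 1 := ⟨N - 1, by omega⟩
  have hempty : (κ ≤ 2 ∧ M ^ 2 ≤ n + 1) ∨ {ω | ∃ μ ∈ Set.Icc (-2 + κ) (2 - κ), ∃ v : Fin (n+1) → ℂ,
            (∑ i, ‖v i‖ ^ 2) = 1 ∧
            (H ω).mulVec v = (μ : ℂ) • v ∧
            ∃ i, M / Real.sqrt ((n+1 : ℕ) : ℝ) ≤ ‖v i‖} = ∅ := by
    by_cases hc : κ ≤ 2 ∧ M ^ 2 ≤ n + 1
    · exact Or.inl hc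
    · right
      rw [Set.eq_empty_iff_forall_notMem]
      rintro ω ⟨μ, hμ, v, hv, -, i, hi⟩
      apply hc
      refine ⟨by linarith [hμ.1, hμ.2], ?_⟩
      have h2 : (M / Real.sqrt ((n+1 : ℕ) : ℝ)) ^ 2 ≤ ‖v i‖ ^ 2 := by gcongr
      have h3 : ‖v i‖ ^ 2 ≤ 1 := by
        rw [← hv]
        exact Finset.single_le_sum (f := fun i => ‖v i‖ ^ 2) (fun i _ => by positivity)
          (Finset.mem_univ i)
      rw [div_pow, Real.sq_sqrt (by positivity), div_le_iff₀ (by positivity)] at h2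
      push_cast at h2
      nlinarith [(by positivity : (0:ℝ) ≤ n)]
  rcases hempty with ⟨hκ2, hMN⟩ | h0
  swap
  · rw [h0]; simp
  have g1 : 1 ≤ c2 * M ^ 2 := by
    have : 1 / c2 ≤ M ^ 2 := by linarith
    rw [div_le_iff₀ hc20] at this; linarith
  have g2 : 1 / (c2 * M ^ 2) ≤ ε := by
    have : 1 / (c2 * ε) ≤ M ^ 2 := by linarith
    rw [div_le_iff₀ (by positivity)] at this
    rw [div_le_iff₀ (by positivity)]; linarith
  have g3 : C3 / M ≤ (δ₀ / 4) ^ 2 := by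
    have : C3 / (δ₀ / 4) ^ 2 ≤ M := by linarith
    rw [div_le_iff₀ (by positivity)] at this
    rw [div_le_iff₀ (by positivity)]; linarith
  refine (prob_main (c5 := c5) W hC hκ hκ2 hc2 hε hC3 hM1 g1 g2 g3
    (by rw [hc5]; exact (min_le_left _ _).trans (min_le_left _ _))
    (by rw [hc5]; exact (min_le_left _ _).trans (min_le_right _ _))
    (by rw [hc5]; exact min_le_right _ _) hMN).trans ?_
  apply ENNReal.ofReal_le_ofReal
  rw [← hQ]
  push_cast at hM
  set q := Real.log ((n:ℝ)+1) with hq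
  have hq2 : q ^ 2 ≤ Real.sqrt M := by
    apply Real.le_sqrt_of_sq_le
    calc (q ^ 2) ^ 2 = q ^ 4 := by ring
      _ ≤ M := hM
  have h4 : ((n:ℝ)+1) ^ 4 = Real.exp (4 * q) := by
    rw [hq, ← Real.exp_log (by positivity : (0:ℝ) < n + 1), ← Real.exp_nat_mul, Real.log_exp]
    norm_num
  have h5 : ((n:ℝ)+1) ^ 4 * Real.exp (-(c5 * Real.sqrt M)) ≤
      Real.exp (8 / c5) * Real.exp (-(c5 / 2 * Real.sqrt M)) := by
    rw [h4, ← Real.exp_add, ← Real.exp_add, Real.exp_le_exp]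
    have h6 : 4 * q ≤ c5 / 2 * q ^ 2 + 8 / c5 := by
      have : c5 / 2 * q ^ 2 + 8 / c5 - 4 * q = (c5 * q - 4) ^ 2 / (2 * c5) := by
        field_simp; ring
      have h7 : 0 ≤ (c5 * q - 4) ^ 2 / (2 * c5) := by positivity
      linarith
    have := mul_le_mul_of_nonneg_left hq2 (by positivity : 0 ≤ c5 / 2)
    linarith
  calc _ ≤ Q * (Real.exp (8 / c5) * Real.exp (-(c5 / 2 * Real.sqrt M))) := by gcongr
    _ = Q * Real.exp (8 / c5) * Real.exp (-(c5 / 2 * Real.sqrt M)) := by ring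
    _ ≤ _ := by
        gcongr
        linarith [Real.exp_pos (c5 / 2 * Real.sqrt M0)]

end
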